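/- arXiv:1901.01959 — 5 statements merged into one kernel-verified Lean document; each statement's English description precedes it below -/
import Mathlib

section
/- Suppose H1 and H2 are vertex-disjoint SBEP subgraphs of a simple graph G, with x1y1 an edge of H1, x2y2 an edge of H2, and such that x1y2 and x2y1 are edges of G. Then there exists an SBEP subgraph H of G with vertex set V(H) = V(H1) ∪ V(H2). -/
open SimpleGraph

variable {V : Type*} {W : Type*}

/-- A graph is `P₄`-free if it contains no induced subgraph isomorphic to the
path on four vertices. -/
def P4Free (G : SimpleGraph V) : Prop := IsEmpty (SimpleGraph.pathGraph 4 ↪g G)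

/-- `R` is (the vertex set of) a connected component of `G - S`:
a maximal subset of `V(G) - S` inducing a connected subgraph. -/
def IsCompOf (G : SimpleGraph V) (S R : Set V) : Prop :=
  R ⊆ Sᶜ ∧ (G.induce R).Connected ∧
    ∀ R' : Set V, R ⊆ R' → R' ⊆ Sᶜ → (G.induce R').Connected → R' = R

/-- The number of connected components of `G - S`. -/
noncomputable def numComp (G : SimpleGraph V) (S : Set V) : ℕ :=
  {R : Set V | IsCompOf G S R}.ncard

/-- `S` is a cutset of `G` : the graph `G - S` is disconnected. -/
def IsCutset (G : SimpleGraph V) (S : Set V) : Prop := 2 ≤ numComp G S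

/-- `G` is `t`-tough: for every cutset `S`, `t * c(G - S) ≤ |S|`. -/
def Tough (t : ℝ) (G : SimpleGraph V) : Prop :=
  ∀ S : Set V, IsCutset G S → t * (numComp G S : ℝ) ≤ (S.ncard : ℝ)

/-- `t` is the toughness of `G` : the largest `s` such that `G` is `s`-tough.
(For a complete graph no such largest `s` exists; the toughness is infinite.) -/
def IsToughness (G : SimpleGraph V) (t : ℝ) : Prop :=
  Tough t G ∧ ∀ s : ℝ, Tough s G → s ≤ t

/-- `S` is a tough-set of `G` (whose toughness is `t`): a cutset with
`|S| = t * c(G - S)`. -/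
def ToughSet (G : SimpleGraph V) (t : ℝ) (S : Set V) : Prop :=
  IsCutset G S ∧ (S.ncard : ℝ) = t * (numComp G S : ℝ)

/-- Vertex `u` is adjacent in `G` to some vertex of the set `R`. -/
def AdjToSet (G : SimpleGraph V) (u : V) (R : Set V) : Prop := ∃ v ∈ R, G.Adj u v

/-- `G` has a Hamiltonian cycle. -/
def HasHamCycle [DecidableEq V] (G : SimpleGraph V) : Prop :=
  ∃ (v : V) (w : G.Walk v v), w.IsHamiltonianCycle

/-- `G` has a spanning `k`-walk: a closed walk visiting every vertex at least once
and at most `k` times.  (In a nontrivial closed walk the base vertex occurs one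
extra time in `Walk.support`, whence the correction term.) -/
def HasSpanningKWalk [DecidableEq V] (G : SimpleGraph V) (k : ℕ) : Prop :=
  ∃ (v : V) (w : G.Walk v v), (∀ x : V, x ∈ w.support) ∧
    ∀ x : V, w.support.count x ≤ k + (if x = v then 1 else 0)

/-- The prism over `G`: the Cartesian (box) product `G □ K₂`. -/
def prism (G : SimpleGraph V) : SimpleGraph (V × Fin 2) :=
  G.boxProd (⊤ : SimpleGraph (Fin 2))

/-- The graph obtained from `G` by contracting the set `R` to a single vertex
(namely `Sum.inr ()`), which is adjacent to exactly those vertices outside `R`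
having a neighbor in `R`. -/
def contractSet (G : SimpleGraph V) (R : Set V) : SimpleGraph (↥(Rᶜ) ⊕ Unit) :=
  SimpleGraph.fromRel fun x y =>
    match x, y with
    | Sum.inl a, Sum.inl b => G.Adj ↑a ↑b
    | Sum.inl a, Sum.inr _ => ∃ r ∈ R, G.Adj ↑a r
    | _, _ => False

/-- `v` is a cutvertex of `H` : deleting `v` leaves a disconnected
(non-preconnected) graph. -/
def IsCutvertex (H : SimpleGraph W) (v : W) : Prop :=
  ¬ (H.induce ({v}ᶜ : Set W)).Preconnected

/-- `B` is a block of `H` : a maximal connected subgraph having no cutvertex of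
its own. -/
def IsBlock (H : SimpleGraph W) (B : H.Subgraph) : Prop :=
  B.coe.Connected ∧ (∀ v, ¬ IsCutvertex B.coe v) ∧
    ∀ B' : H.Subgraph, B ≤ B' → B'.coe.Connected →
      (∀ v, ¬ IsCutvertex B'.coe v) → B' = B

/-- `H` is a cycle of even length. -/
def IsEvenCycleGraph (H : SimpleGraph W) : Prop :=
  ∃ n : ℕ, Even n ∧ 3 ≤ n ∧ Nonempty (H ≃g SimpleGraph.cycleGraph n)

/-- `H` is a single edge. -/
def IsSingleEdgeGraph (H : SimpleGraph W) : Prop :=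
  ∃ u v : W, u ≠ v ∧ H.Adj u v ∧ ∀ w : W, w = u ∨ w = v

/-- `H` is a simple block EP (SBEP) graph: a connected graph in which every block
is an even cycle or a single edge, and every vertex lies in at most two blocks. -/
def IsSBEP (H : SimpleGraph W) : Prop :=
  H.Connected ∧
    (∀ B : H.Subgraph, IsBlock H B → IsEvenCycleGraph B.coe ∨ IsSingleEdgeGraph B.coe) ∧
    ∀ (v : W) (B₁ B₂ B₃ : H.Subgraph),
      IsBlock H B₁ ∧ v ∈ B₁.verts → IsBlock H B₂ ∧ v ∈ B₂.verts →
      IsBlock H B₃ ∧ v ∈ B₃.verts → B₁ = B₂ ∨ B₁ = B₃ ∨ B₂ = B₃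

/-- `v` is a single-block vertex of `H` : it lies in exactly one block. -/
def SingleBlockVertex (H : SimpleGraph W) (v : W) : Prop :=
  ∃! B : H.Subgraph, IsBlock H B ∧ v ∈ B.verts

open Relation

/-- A graph is nonseparable if it is connected and has no cutvertex. -/
def Nonseparable (K : SimpleGraph W) : Prop :=
  K.Connected ∧ ∀ v, ¬ IsCutvertex K v

/-- Any two vertices of `B` in `T` are joined by a walk of `B` inside `T`. -/
def LinkedIn {G : SimpleGraph V} (B : G.Subgraph) (T : Set V) : Prop :=
  ∀ u ∈ B.verts, u ∈ T → ∀ w ∈ B.verts, w ∈ T →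
    ReflTransGen (fun a b => B.Adj a b ∧ a ∈ T ∧ b ∈ T) u w

/-- `B` is an even cycle, where a single edge counts as a cycle of length two. -/
def IsEvenCycle {G : SimpleGraph V} (B : G.Subgraph) : Prop :=
  ∃ k : ℕ, Nonempty (B.coe ≃g cycleGraph (2 * k + 2))

theorem IsCutvertex.of_iso {W' : Type*} {K : SimpleGraph W} {K' : SimpleGraph W'} (e : K ≃g K')
    {v : W} (h : IsCutvertex K v) : IsCutvertex K' (e v) := by
  intro hp
  refine h ((Iso.preconnected_iff (e.induce (s := {v}ᶜ) (t := {e v}ᶜ) ?_)).2 hp)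
  refine ⟨fun a ha => ?_, e.injective.injOn, fun b hb => ⟨e.symm b, ?_, by simp⟩⟩
  · simpa using ha
  · rintro rfl
    simp at hb

theorem Nonseparable.of_iso {W' : Type*} {K : SimpleGraph W} {K' : SimpleGraph W'} (e : K ≃g K')
    (h : Nonseparable K) : Nonseparable K' := by
  refine ⟨e.connected_iff.1 h.1, fun v hv => h.2 (e.symm v) ?_⟩
  exact hv.of_iso e.symm

theorem preconnected_induce_coe_iff {G : SimpleGraph V} {B : G.Subgraph} {T : Set V} :
    (B.coe.induce (Subtype.val ⁻¹' T)).Preconnected ↔ LinkedIn B T := by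
  constructor
  · intro h u hu huT w hw hwT
    have := (reachable_iff_reflTransGen _ _).1 (h ⟨⟨u, hu⟩, huT⟩ ⟨⟨w, hw⟩, hwT⟩)
    exact ReflTransGen.lift (p := fun a b => B.Adj a b ∧ a ∈ T ∧ b ∈ T)
      (fun z : (Subtype.val ⁻¹' T : Set B.verts) => z.1.1) (fun a b hab => ⟨hab, a.2, b.2⟩) _ _ this
  · rintro h ⟨⟨u, hu⟩, huT⟩ ⟨⟨w, hw⟩, hwT⟩
    have := h u hu huT w hw hwT
    induction this using ReflTransGen.head_induction_on with
    | refl => rfl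
    | head hab _ ih =>
      refine Reachable.trans (Adj.reachable ?_) (ih hab.1.snd_mem hab.2.2)
      exact hab.1

theorem nonseparable_coe_iff {G : SimpleGraph V} {B : G.Subgraph} :
    Nonseparable B.coe ↔
      B.verts.Nonempty ∧ LinkedIn B Set.univ ∧ ∀ x, LinkedIn B {x}ᶜ := by
  have h0 : B.coe.Preconnected ↔ LinkedIn B Set.univ := by
    rw [← preconnected_induce_coe_iff]
    exact (Iso.preconnected_iff (induceUnivIso B.coe)).symm
  have h1 : ∀ v : B.verts, ¬ IsCutvertex B.coe v ↔ LinkedIn B {v.1}ᶜ := by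
    intro v
    rw [← preconnected_induce_coe_iff, IsCutvertex, not_not]
    have : ({v}ᶜ : Set B.verts) = Subtype.val ⁻¹' {v.1}ᶜ := by
      ext z
      simp [Subtype.ext_iff]
    rw [this]
  constructor
  · rintro ⟨hc, hv⟩
    have hl := h0.1 hc.preconnected
    refine ⟨Set.nonempty_coe_sort.1 hc.nonempty, hl, fun x => ?_⟩
    by_cases hx : x ∈ B.verts
    · exact (h1 ⟨x, hx⟩).1 (hv _)
    · intro u hu _ w hw _
      refine ReflTransGen.mono (fun a b hab => ⟨hab.1, ?_, ?_⟩) _ _ (hl u hu trivial w hw trivial)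
      · rintro rfl
        exact hx hab.1.fst_mem
      · rintro rfl
        exact hx hab.1.snd_mem
  · rintro ⟨hne, hl, hx⟩
    have := hne.to_subtype
    exact ⟨⟨h0.2 hl⟩, fun v => (h1 v).2 (hx _)⟩

theorem nonseparable_cycleGraph (n : ℕ) : Nonseparable (cycleGraph (n + 2)) := by
  refine ⟨cycleGraph_connected, fun v hv => hv ?_⟩
  have key : ∀ j : ℕ, ∀ hj : j < n + 1, ∀ h0 : v + 1 ≠ v, ∀ h : v + 1 + Fin.ofNat (n + 2) j ≠ v,
      ((cycleGraph (n + 2)).induce ({v}ᶜ : Set _)).Reachable ⟨v + 1, h0⟩ ⟨_, h⟩ := by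
    intro j
    induction j with
    | zero =>
      intro _ h0 h
      have : v + 1 = v + 1 + Fin.ofNat (n + 2) 0 := by simp
      simp only [← this]
      rfl
    | succ j ih =>
      intro hj h0 h
      have h' : v + 1 + Fin.ofNat (n + 2) j ≠ v := by
        intro hh
        have h2 : 1 + Fin.ofNat (n + 2) j = 0 := by
          rw [add_assoc] at hh
          simpa using hh
        have := congrArg Fin.val h2
        simp [Fin.val_add] at this
        rw [Nat.mod_eq_of_lt (by omega)] at this
        omega
      refine (ih (by omega) h0 h').trans (Adj.reachable ?_)
      simp only [comap_adj, Function.Embedding.subtype_apply, cycleGraph_adj]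
      right
      have : Fin.ofNat (n + 2) (j + 1) = Fin.ofNat (n + 2) j + 1 := by
        ext
        simp [Fin.val_add]
      rw [this]
      abel
  have h0 : v + 1 ≠ v := by simp
  have all : ∀ u : ({v}ᶜ : Set (Fin (n + 2))),
      ((cycleGraph (n + 2)).induce ({v}ᶜ : Set _)).Reachable ⟨v + 1, h0⟩ u := by
    rintro ⟨u, hu⟩
    have hu' : u ≠ v := hu
    have e : u = v + 1 + Fin.ofNat (n + 2) (u - (v + 1)).val := by simp
    have hlt : (u - (v + 1)).val < n + 1 := by
      by_contra hge
      have hlast : u - (v + 1) = Fin.last (n + 1) := by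
        ext
        have := (u - (v + 1)).isLt
        simp only [Fin.val_last]
        omega
      have : u = v + (1 + Fin.last (n + 1)) := by
        rw [← hlast]
        abel
      apply hu'
      rw [this, add_comm 1, Fin.last_add_one, add_zero]
    have := key _ hlt h0 (e ▸ hu')
    simp only [← e] at this
    exact this
  exact fun u w => (all u).symm.trans (all w)

theorem IsEvenCycle.nonseparable {G : SimpleGraph V} {B : G.Subgraph} (h : IsEvenCycle B) :
    Nonseparable B.coe := by
  obtain ⟨k, ⟨e⟩⟩ := h
  exact (nonseparable_cycleGraph _).of_iso e.symm

theorem IsEvenCycle.congr {V' : Type*} {G : SimpleGraph V} {B : G.Subgraph} {G' : SimpleGraph V'}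
    {B' : G'.Subgraph} (e : B.coe ≃g B'.coe) (h : IsEvenCycle B) : IsEvenCycle B' := by
  obtain ⟨k, ⟨f⟩⟩ := h
  exact ⟨k, ⟨e.symm.trans f⟩⟩

theorem isEvenCycle_iff {G : SimpleGraph V} {B : G.Subgraph} :
    IsEvenCycle B ↔ IsEvenCycleGraph B.coe ∨ IsSingleEdgeGraph B.coe := by
  constructor
  · rintro ⟨k, ⟨e⟩⟩
    rcases k with _ | k
    · right
      refine ⟨e.symm 0, e.symm 1, by simp, e.symm.map_adj_iff.2 ?_, fun w => ?_⟩
      · simp [cycleGraph_two_eq_top]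
      · rcases Fin.exists_fin_two.1 ⟨e w, rfl⟩ with h | h
        · left; rw [← h]; simp
        · right; rw [← h]; simp
    · left
      exact ⟨2 * (k + 1) + 2, ⟨k + 2, by ring⟩, by omega, ⟨e⟩⟩
  · rintro (⟨n, ⟨m, hm⟩, h3, ⟨e⟩⟩ | ⟨u, v, huv, hadj, hall⟩)
    · obtain ⟨k, rfl⟩ : ∃ k, n = 2 * k + 2 := ⟨m - 1, by omega⟩
      exact ⟨k, ⟨e⟩⟩
    · refine ⟨0, ⟨?_⟩⟩
      have htop : B.coe = ⊤ := by
        ext a b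
        rw [top_adj]
        refine ⟨fun h => h.ne, fun h => ?_⟩
        rcases hall a with rfl | rfl <;> rcases hall b with rfl | rfl
        exacts [(h rfl).elim, hadj, hadj.symm, (h rfl).elim]
      have huniv : (Set.univ : Set B.verts) = {u, v} := by
        ext w
        simpa using hall w
      have hcard : Nat.card B.verts = 2 := by
        rw [← Set.ncard_univ, huniv, Set.ncard_pair huv]
      have : Finite B.verts := Nat.finite_of_card_ne_zero (by omega)
      rw [htop, show (2 * 0 + 2) = 2 from rfl, cycleGraph_two_eq_top]
      exact Iso.completeGraph (Finite.equivFinOfCardEq hcard)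

/-- A subgraph of a subgraph `H` of `G` is isomorphic to its image in `G`. -/
noncomputable def coeSubgraphIso {G : SimpleGraph V} {H : G.Subgraph} (B : H.coe.Subgraph) :
    B.coe ≃g (Subgraph.coeSubgraph B).coe where
  toEquiv := Equiv.ofBijective
    (fun v => (⟨v.1.1, v.1, v.2, rfl⟩ : (Subgraph.coeSubgraph B).verts)) (by
      constructor
      · rintro ⟨⟨a, ha⟩, ha'⟩ ⟨⟨b, hb⟩, hb'⟩ hab
        have : a = b := congrArg Subtype.val hab
        exact Subtype.ext (Subtype.ext this)
      · rintro ⟨_, ⟨a, ha⟩, ha', rfl⟩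
        exact ⟨⟨⟨a, ha⟩, ha'⟩, rfl⟩)
  map_rel_iff' := by
    rintro ⟨⟨a, ha⟩, ha'⟩ ⟨⟨b, hb⟩, hb'⟩
    exact (Subgraph.coeSubgraph_adj B a b).trans ⟨fun ⟨_, _, h⟩ => h, fun h => ⟨ha, hb, h⟩⟩

theorem coeSubgraph_restrict_of_le {G : SimpleGraph V} {H C : G.Subgraph} (h : C ≤ H) :
    Subgraph.coeSubgraph (H.restrict C) = C := by
  rw [Subgraph.coeSubgraph_restrict_eq, inf_eq_right.2 h]

theorem isBlock_iff {G : SimpleGraph V} {H : G.Subgraph} {B : H.coe.Subgraph} :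
    IsBlock H.coe B ↔
      Maximal (fun C : G.Subgraph => C ≤ H ∧ Nonseparable C.coe) (Subgraph.coeSubgraph B) := by
  constructor
  · rintro ⟨hc, hv, hmax⟩
    refine ⟨⟨Subgraph.coeSubgraph_le B, Nonseparable.of_iso (coeSubgraphIso B) ⟨hc, hv⟩⟩, ?_⟩
    rintro C ⟨hCH, hC⟩ hle
    have hC' : Nonseparable (H.restrict C).coe := by
      rw [← coeSubgraph_restrict_of_le hCH] at hC
      exact hC.of_iso (coeSubgraphIso _).symm
    have hB : B ≤ H.restrict C := by
      rw [← Subgraph.restrict_coeSubgraph B]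
      exact Subgraph.comap_monotone _ hle
    rw [← hmax _ hB hC'.1 hC'.2, coeSubgraph_restrict_of_le hCH]
  · rintro ⟨⟨_, hB⟩, hmax⟩
    have hB' := hB.of_iso (coeSubgraphIso B).symm
    refine ⟨hB'.1, hB'.2, fun C hle hc hv => Subgraph.coeSubgraph_injective _ ?_⟩
    have hle' := Subgraph.map_mono (f := H.hom) hle
    refine le_antisymm (hmax ⟨Subgraph.coeSubgraph_le C, ?_⟩ hle') hle'
    exact Nonseparable.of_iso (coeSubgraphIso C) ⟨hc, hv⟩

theorem linkedIn_univ_iff {G : SimpleGraph V} {B : G.Subgraph} :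
    LinkedIn B Set.univ ↔ ∀ u ∈ B.verts, ∀ w ∈ B.verts, ReflTransGen B.Adj u w := by
  simp [LinkedIn]

theorem reflTransGen_adj_symm {G : SimpleGraph V} {B : G.Subgraph} {T : Set V} {u w : V}
    (h : ReflTransGen (fun a b => B.Adj a b ∧ a ∈ T ∧ b ∈ T) u w) :
    ReflTransGen (fun a b => B.Adj a b ∧ a ∈ T ∧ b ∈ T) w u := by
  have : Std.Symm (fun a b => B.Adj a b ∧ a ∈ T ∧ b ∈ T) :=
    ⟨fun a b hab => ⟨hab.1.symm, hab.2.2, hab.2.1⟩⟩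
  exact Std.Symm.symm _ _ h

theorem LinkedIn.sup {G : SimpleGraph V} {B P : G.Subgraph} {T : Set V} (hB : LinkedIn B T)
    (hP : ∀ y ∈ P.verts, y ∈ T → ∃ z ∈ B.verts, z ∈ T ∧
      ReflTransGen (fun a b => P.Adj a b ∧ a ∈ T ∧ b ∈ T) y z) :
    LinkedIn (B ⊔ P) T := by
  have key : ∀ y ∈ (B ⊔ P).verts, y ∈ T → ∃ z ∈ B.verts, z ∈ T ∧
      ReflTransGen (fun a b => (B ⊔ P).Adj a b ∧ a ∈ T ∧ b ∈ T) y z := by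
    rintro y (hy | hy) hyT
    · exact ⟨y, hy, hyT, .refl⟩
    · obtain ⟨z, hz, hzT, h⟩ := hP y hy hyT
      exact ⟨z, hz, hzT, ReflTransGen.mono (fun a b hab => ⟨Or.inr hab.1, hab.2⟩) _ _ h⟩
  intro u hu huT w hw hwT
  obtain ⟨u', hu', huT', h1⟩ := key u hu huT
  obtain ⟨w', hw', hwT', h2⟩ := key w hw hwT
  refine (h1.trans ?_).trans (reflTransGen_adj_symm h2)
  exact ReflTransGen.mono (fun a b hab => ⟨Or.inl hab.1, hab.2⟩) _ _ (hB u' hu' huT' w' hw' hwT')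

/-- Attaching to a nonseparable graph `B` a graph `P` that stays attached to `B` after the
deletion of any vertex yields a nonseparable graph. -/
theorem Nonseparable.sup {G : SimpleGraph V} {B P : G.Subgraph} (hB : Nonseparable B.coe)
    (hP : ∀ x, ∀ y ∈ P.verts, y ≠ x → ∃ z ∈ B.verts, z ≠ x ∧
      ReflTransGen (fun a b => P.Adj a b ∧ a ∈ ({x}ᶜ : Set V) ∧ b ∈ ({x}ᶜ : Set V)) y z) :
    Nonseparable (B ⊔ P).coe := by
  rw [nonseparable_coe_iff] at hB ⊢
  obtain ⟨⟨b, hb⟩, hu, hx⟩ := hB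
  refine ⟨⟨b, Or.inl hb⟩, hu.sup fun y hy _ => ?_, fun x => (hx x).sup (hP x)⟩
  by_cases hyb : y = b
  · exact ⟨b, hb, trivial, hyb ▸ .refl⟩
  · obtain ⟨z, hz, _, h⟩ := hP b y hy hyb
    exact ⟨z, hz, trivial, ReflTransGen.mono (fun a b hab => ⟨hab.1, trivial, trivial⟩) _ _ h⟩

/-- Two blocks sharing two vertices coincide. -/
theorem eq_of_maximal_of_mem {G : SimpleGraph V} {H B B' : G.Subgraph}
    (hB : Maximal (fun C : G.Subgraph => C ≤ H ∧ Nonseparable C.coe) B)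
    (hB' : Maximal (fun C : G.Subgraph => C ≤ H ∧ Nonseparable C.coe) B')
    {u v : V} (huv : u ≠ v) (hu : u ∈ B.verts) (hv : v ∈ B.verts) (hu' : u ∈ B'.verts)
    (hv' : v ∈ B'.verts) : B = B' := by
  have hsup : B ⊔ B' ≤ H ∧ Nonseparable (B ⊔ B').coe := by
    refine ⟨sup_le hB.prop.1 hB'.prop.1, hB.prop.2.sup fun x y hy hyx => ?_⟩
    obtain ⟨-, -, hl⟩ := nonseparable_coe_iff.1 hB'.prop.2
    by_cases hux : u = x
    · have hvx : v ≠ x := fun h => huv (hux.trans h.symm)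
      exact ⟨v, hv, hvx, hl x y hy hyx v hv' hvx⟩
    · exact ⟨u, hu, hux, hl x y hy hyx u hu' hux⟩
  exact (hB.eq_of_le hsup le_sup_left).trans (hB'.eq_of_le hsup le_sup_right).symm

theorem reflTransGen_of_mem_support {K : SimpleGraph V} {u v x : V} (p : K.Walk u v)
    (hx : x ∉ p.support) :
    ReflTransGen (fun a b => s(a, b) ∈ p.edges ∧ a ≠ x ∧ b ≠ x) u v := by
  induction p with
  | nil => exact .refl
  | cons h p ih =>
    simp only [Walk.support_cons, List.mem_cons, not_or] at hx
    refine ReflTransGen.head ⟨by simp, Ne.symm hx.1, ?_⟩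
      (ReflTransGen.mono (fun a b hab => ⟨by simp [hab.1], hab.2⟩) _ _ (ih hx.2))
    rintro rfl
    exact hx.2 p.start_mem_support

/-- Two vertices of a block `B` of `H` are not joined by a walk of `H` that avoids the edges
of `B`. -/
theorem eq_of_reachable_sdiff {G : SimpleGraph V} {H B : G.Subgraph}
    (hB : Maximal (fun C : G.Subgraph => C ≤ H ∧ Nonseparable C.coe) B)
    {u v : V} (hu : u ∈ B.verts) (hv : v ∈ B.verts)
    (h : (H.spanningCoe \ B.spanningCoe).Reachable u v) : u = v := by
  classical
  by_contra huv
  obtain ⟨p, hp⟩ := h.exists_isPath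
  have hle : H.spanningCoe \ B.spanningCoe ≤ G := fun a b hab => H.adj_sub hab.1
  set P : G.Subgraph := (p.mapLe hle).toSubgraph with hP
  have hPadj : ∀ a b, P.Adj a b ↔ s(a, b) ∈ p.edges := by
    intro a b
    rw [hP, Walk.adj_toSubgraph_iff_mem_edges]
    simp
  have hPverts : ∀ a, a ∈ P.verts ↔ a ∈ p.support := by
    intro a
    rw [hP, Walk.mem_verts_toSubgraph]
    simp
  have hdiff : ∀ a b, P.Adj a b → H.Adj a b ∧ ¬ B.Adj a b := fun a b hab =>
    p.adj_of_mem_edges ((hPadj a b).1 hab)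
  have hPH : P ≤ H := by
    refine ⟨fun a ha => ?_, fun a b hab => (hdiff a b hab).1⟩
    rw [hPverts] at ha
    by_cases hav : a = v
    · exact hav ▸ hB.prop.1.1 hv
    · obtain ⟨e, he, hae⟩ := (p.mem_support_iff_exists_mem_edges).1 ha |>.resolve_left hav
      induction e with
      | _ b c =>
        have := (hdiff b c ((hPadj b c).2 he)).1
        rcases Sym2.mem_iff.1 hae with rfl | rfl
        exacts [this.fst_mem, this.snd_mem]
  have hsup : B ⊔ P ≤ H ∧ Nonseparable (B ⊔ P).coe := by
    refine ⟨sup_le hB.prop.1 hPH, hB.prop.2.sup fun x y hy hyx => ?_⟩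
    rw [hPverts] at hy
    by_cases hx : x ∈ (p.takeUntil y hy).support
    · have hx' : x ∉ (p.dropUntil y hy).support := by
        intro hx'
        have h1 := hp.support_nodup
        rw [← p.take_spec hy, Walk.support_append, List.nodup_append] at h1
        rw [← Walk.cons_tail_support, List.mem_cons] at hx'
        exact h1.2.2 x hx x (hx'.resolve_left hyx.symm) rfl
      refine ⟨v, hv, ?_, ?_⟩
      · rintro rfl
        exact hx' (Walk.end_mem_support _)
      · refine ReflTransGen.mono (fun a b hab => ⟨(hPadj a b).2 ?_, hab.2⟩) _ _
          (reflTransGen_of_mem_support _ hx')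
        exact p.edges_dropUntil_subset_edges hy hab.1
    · refine ⟨u, hu, ?_, reflTransGen_adj_symm ?_⟩
      · rintro rfl
        exact hx (Walk.start_mem_support _)
      · refine ReflTransGen.mono (fun a b hab => ⟨(hPadj a b).2 ?_, hab.2⟩) _ _
          (reflTransGen_of_mem_support _ hx)
        exact p.edges_takeUntil_subset_edges hy hab.1
  have hPB : P ≤ B := hB.eq_of_le hsup le_sup_left ▸ le_sup_right
  cases p with
  | nil => exact huv rfl
  | @cons _ w _ hadj q =>
    have h1 := (hPadj u w).2 (by simp)
    exact (hdiff _ _ h1).2 (hPB.2 h1)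

/-- The members of `𝓑` are even cycles or edges, glued along vertices in a tree-like fashion
with at most two members meeting at each vertex. -/
structure IsBlockTree {G : SimpleGraph V} (𝓑 : Set G.Subgraph) : Prop where
  isEvenCycle : ∀ B ∈ 𝓑, IsEvenCycle B
  linked : LinkedIn (sSup 𝓑) Set.univ
  exists_proj : ∀ B ∈ 𝓑, ∃ r : V → V, (∀ v ∈ B.verts, r v = v) ∧
    (∀ v ∈ (sSup 𝓑).verts, r v ∈ B.verts) ∧
    ∀ B' ∈ 𝓑, B' ≠ B → ∀ u ∈ B'.verts, ∀ v ∈ B'.verts, r u = r v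
  mem_at_most_two : ∀ v, ∀ B₁ ∈ 𝓑, ∀ B₂ ∈ 𝓑, ∀ B₃ ∈ 𝓑, v ∈ B₁.verts → v ∈ B₂.verts →
    v ∈ B₃.verts → B₁ = B₂ ∨ B₁ = B₃ ∨ B₂ = B₃

theorem mem_verts_sSup {G : SimpleGraph V} {𝓑 : Set G.Subgraph} {v : V} :
    v ∈ (sSup 𝓑).verts ↔ ∃ B ∈ 𝓑, v ∈ B.verts := by
  simp [Subgraph.verts_sSup]

theorem exists_proj_of_maximal {G : SimpleGraph V} {H B : G.Subgraph} (hH : LinkedIn H Set.univ)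
    (hB : Maximal (fun C : G.Subgraph => C ≤ H ∧ Nonseparable C.coe) B) :
    ∃ r : V → V, (∀ v ∈ B.verts, r v = v) ∧ (∀ v ∈ H.verts, r v ∈ B.verts) ∧
      ∀ B', Maximal (fun C : G.Subgraph => C ≤ H ∧ Nonseparable C.coe) B' → B' ≠ B →
        ∀ u ∈ B'.verts, ∀ v ∈ B'.verts, r u = r v := by
  classical
  obtain ⟨⟨b, hb⟩, -, -⟩ := nonseparable_coe_iff.1 hB.prop.2
  rw [linkedIn_univ_iff] at hH
  have hex : ∀ v, ∃ w, w ∈ B.verts ∧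
      (v ∈ H.verts → (H.spanningCoe \ B.spanningCoe).Reachable v w) := by
    intro v
    by_cases hv : v ∈ H.verts
    · have := hH v hv b (hB.prop.1.1 hb)
      induction this using ReflTransGen.head_induction_on with
      | refl => exact ⟨b, hb, fun _ => .refl _⟩
      | @head a c hac _ ih =>
        by_cases ha : a ∈ B.verts
        · exact ⟨a, ha, fun _ => .refl _⟩
        · obtain ⟨w, hw, hcw⟩ := ih hac.snd_mem
          refine ⟨w, hw, fun _ => Reachable.trans (Adj.reachable ?_) (hcw hac.snd_mem)⟩
          exact ⟨hac, fun h => ha h.fst_mem⟩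
    · exact ⟨b, hb, fun h => (hv h).elim⟩
  choose r hrB hr using hex
  refine ⟨r, fun v hv => ?_, fun v _ => hrB v, fun B' hB' hne => ?_⟩
  · exact (eq_of_reachable_sdiff hB hv (hrB v) (hr v (hB.prop.1.1 hv))).symm
  · have hstep : ∀ u v, B'.Adj u v → r u = r v := by
      intro u v huv
      have huv' := hB'.prop.1.2 huv
      refine eq_of_reachable_sdiff hB (hrB u) (hrB v) ?_
      refine (hr u huv'.fst_mem).symm.trans ((Adj.reachable ?_).trans (hr v huv'.snd_mem))
      refine ⟨huv', fun h => hne ?_⟩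
      exact eq_of_maximal_of_mem hB' hB huv.ne huv.fst_mem huv.snd_mem h.fst_mem h.snd_mem
    intro u hu v hv
    have := linkedIn_univ_iff.1 (nonseparable_coe_iff.1 hB'.prop.2).2.1 u hu v hv
    induction this with
    | refl => rfl
    | tail _ h ih => exact (ih h.fst_mem).trans (hstep _ _ h)

theorem nonseparable_singletonSubgraph (G : SimpleGraph V) (v : V) :
    Nonseparable (G.singletonSubgraph v).coe := by
  rw [nonseparable_coe_iff]
  refine ⟨⟨v, rfl⟩, ?_, ?_⟩ <;>
  · intros
    intro u hu huT w hw hwT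
    obtain rfl : u = v := hu
    obtain rfl : w = u := hw
    exact .refl

theorem nonseparable_subgraphOfAdj {G : SimpleGraph V} {u v : V} (h : G.Adj u v) :
    Nonseparable (G.subgraphOfAdj h).coe := by
  rw [nonseparable_coe_iff]
  have hl : ∀ T : Set V, LinkedIn (G.subgraphOfAdj h) T := by
    intro T a ha haT b hb hbT
    by_cases hab : a = b
    · exact hab ▸ .refl
    · refine .single ⟨?_, haT, hbT⟩
      simp at ha hb ⊢
      grind
  exact ⟨⟨u, by simp⟩, hl _, fun _ => hl _⟩

theorem exists_isBlockTree [Finite V] {G : SimpleGraph V} {H : G.Subgraph} (h : IsSBEP H.coe) :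
    ∃ 𝓑 : Set G.Subgraph, IsBlockTree 𝓑 ∧ sSup 𝓑 = H := by
  obtain ⟨hc, hcyc, htwo⟩ := h
  set 𝓑 : Set G.Subgraph := {B | Maximal (fun C : G.Subgraph => C ≤ H ∧ Nonseparable C.coe) B}
  have h𝓑H : ∀ B ∈ 𝓑, B ≤ H := fun B hB => (Maximal.prop (Set.mem_ofPred.1 hB)).1
  have hblock : ∀ B ∈ 𝓑, ∃ B' : H.coe.Subgraph, IsBlock H.coe B' ∧ Subgraph.coeSubgraph B' = B := by
    intro B hB
    refine ⟨H.restrict B, ?_, coeSubgraph_restrict_of_le (h𝓑H B hB)⟩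
    rw [isBlock_iff, coeSubgraph_restrict_of_le (h𝓑H B hB)]
    exact hB
  have hmax : ∀ C : G.Subgraph, C ≤ H → Nonseparable C.coe → ∃ B ∈ 𝓑, C ≤ B := by
    intro C hC hC'
    obtain ⟨B, hCB, hB⟩ := (Set.toFinite
      {C : G.Subgraph | C ≤ H ∧ Nonseparable C.coe}).exists_le_maximal ⟨hC, hC'⟩
    exact ⟨B, hB, hCB⟩
  have hsup : sSup 𝓑 = H := by
    refine le_antisymm (sSup_le h𝓑H) ⟨fun v hv => ?_, fun u v huv => ?_⟩
    · obtain ⟨B, hB, hle⟩ := hmax _ ((singletonSubgraph_le_iff v H).2 hv)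
        (nonseparable_singletonSubgraph G v)
      exact mem_verts_sSup.2 ⟨B, hB, hle.1 rfl⟩
    · have hle : G.subgraphOfAdj (H.adj_sub huv) ≤ H := subgraphOfAdj_le_of_adj _ huv
      obtain ⟨B, hB, hle⟩ := hmax _ hle (nonseparable_subgraphOfAdj _)
      exact Subgraph.sSup_adj.2 ⟨B, hB, hle.2 (by simp)⟩
  have hlink : LinkedIn H Set.univ := by
    rw [← preconnected_induce_coe_iff]
    exact (Iso.preconnected_iff (induceUnivIso H.coe)).2 hc.preconnected
  refine ⟨𝓑, ⟨fun B hB => ?_, hsup ▸ hlink, fun B hB => ?_, ?_⟩, hsup⟩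
  · obtain ⟨B', hB', rfl⟩ := hblock B hB
    exact IsEvenCycle.congr (coeSubgraphIso B') (isEvenCycle_iff.2 (hcyc B' hB'))
  · rw [hsup]
    exact exists_proj_of_maximal hlink hB
  · intro v B₁ hB₁ B₂ hB₂ B₃ hB₃ h₁ h₂ h₃
    obtain ⟨C₁, hC₁, rfl⟩ := hblock B₁ hB₁
    obtain ⟨C₂, hC₂, rfl⟩ := hblock B₂ hB₂
    obtain ⟨C₃, hC₃, rfl⟩ := hblock B₃ hB₃
    obtain ⟨⟨v, hv⟩, h₁, rfl⟩ := h₁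
    have h₂' : ⟨v, hv⟩ ∈ C₂.verts := by
      obtain ⟨_, h, rfl⟩ := h₂
      exact h
    have h₃' : ⟨v, hv⟩ ∈ C₃.verts := by
      obtain ⟨_, h, rfl⟩ := h₃
      exact h
    have := htwo ⟨v, hv⟩ C₁ C₂ C₃ ⟨hC₁, h₁⟩ ⟨hC₂, h₂'⟩ ⟨hC₃, h₃'⟩
    grind

theorem IsBlockTree.exists_le {G : SimpleGraph V} {𝓑 : Set G.Subgraph} (h : IsBlockTree 𝓑)
    {C : G.Subgraph} (hC : C ≤ sSup 𝓑) (hC' : Nonseparable C.coe) : ∃ B ∈ 𝓑, C ≤ B := by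
  obtain ⟨⟨c, hc⟩, hl, hsep⟩ := nonseparable_coe_iff.1 hC'
  by_cases hadj : ∃ a b, C.Adj a b
  · obtain ⟨a, b, hab⟩ := hadj
    obtain ⟨B, hB, habB⟩ := Subgraph.sSup_adj.1 (hC.2 hab)
    obtain ⟨r, hrB, hrm, hr⟩ := h.exists_proj B hB
    have hstep : ∀ u v, C.Adj u v → B.Adj u v ∨ r u = r v := by
      intro u v huv
      obtain ⟨B', hB', huv'⟩ := Subgraph.sSup_adj.1 (hC.2 huv)
      by_cases hBB : B' = B
      · exact Or.inl (hBB ▸ huv')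
      · exact Or.inr (hr B' hB' hBB u huv'.fst_mem v huv'.snd_mem)
    have hverts : C.verts ⊆ B.verts := by
      intro c hc
      by_contra hcB
      have hne : c ≠ r c := fun he => hcB (he ▸ hrm c (hC.1 hc))
      have key : ∀ d, d ∈ C.verts → d ∈ B.verts → d ≠ r c → False := by
        intro d hd hdB hdr
        have := hsep (r c) c hc hne d hd hdr
        have hrd : r d = r c := by
          clear hdB hd
          induction this with
          | refl => rfl
          | @tail y z hyz hy ih =>
            rcases hstep y z hy.1 with hB' | he
            · have := ih hy.2.1
              rw [hrB y hB'.fst_mem] at this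
              exact (hy.2.1 this).elim
            · rw [← he]
              exact ih hy.2.1
        exact hdr ((hrB d hdB).symm.trans hrd)
      by_cases har : a = r c
      · exact key b hab.snd_mem habB.snd_mem fun hbr => hab.ne (har.trans hbr.symm)
      · exact key a hab.fst_mem habB.fst_mem har
    refine ⟨B, hB, hverts, fun u v huv => (hstep u v huv).resolve_right fun he => huv.ne ?_⟩
    rwa [hrB u (hverts huv.fst_mem), hrB v (hverts huv.snd_mem)] at he
  · push Not at hadj
    obtain ⟨B, hB, hcB⟩ := mem_verts_sSup.1 (hC.1 hc)
    refine ⟨B, hB, fun d hd => ?_, fun a b hab => (hadj a b hab).elim⟩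
    rcases ReflTransGen.cases_head (linkedIn_univ_iff.1 hl d hd c hc) with rfl | ⟨e, he, -⟩
    · exact hcB
    · exact (hadj _ _ he).elim

theorem IsBlockTree.isSBEP {G : SimpleGraph V} {𝓑 : Set G.Subgraph} (h : IsBlockTree 𝓑)
    (hne : (sSup 𝓑).verts.Nonempty) : IsSBEP (sSup 𝓑).coe := by
  have hmem : ∀ B : (sSup 𝓑).coe.Subgraph, IsBlock (sSup 𝓑).coe B →
      Subgraph.coeSubgraph B ∈ 𝓑 := by
    intro B hB
    rw [isBlock_iff] at hB
    obtain ⟨C, hC, hle⟩ := h.exists_le hB.prop.1 hB.prop.2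
    rwa [hB.eq_of_le ⟨le_sSup hC, (h.isEvenCycle C hC).nonseparable⟩ hle]
  refine ⟨?_, fun B hB => ?_, fun v B₁ B₂ B₃ h₁ h₂ h₃ => ?_⟩
  · have := hne.to_subtype
    exact ⟨(Iso.preconnected_iff (induceUnivIso _)).1 (preconnected_induce_coe_iff.2 h.linked)⟩
  · exact isEvenCycle_iff.1 ((h.isEvenCycle _ (hmem B hB)).congr (coeSubgraphIso B).symm)
  · simp only [← (Subgraph.coeSubgraph_injective (sSup 𝓑)).eq_iff]
    exact h.mem_at_most_two v _ (hmem _ h₁.1) _ (hmem _ h₂.1) _ (hmem _ h₃.1)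
      ⟨v, h₁.2, rfl⟩ ⟨v, h₂.2, rfl⟩ ⟨v, h₃.2, rfl⟩

section Merge

variable {G : SimpleGraph V} {𝓑₁ 𝓑₂ : Set G.Subgraph} {B₁ B₂ C : G.Subgraph}

theorem verts_sSup_merge (hB₁ : B₁ ∈ 𝓑₁) (hB₂ : B₂ ∈ 𝓑₂) (hCv : C.verts = B₁.verts ∪ B₂.verts) :
    (sSup (insert C (𝓑₁ \ {B₁} ∪ 𝓑₂ \ {B₂}))).verts = (sSup 𝓑₁).verts ∪ (sSup 𝓑₂).verts := by
  ext v
  simp only [Set.mem_union, mem_verts_sSup]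
  constructor
  · rintro ⟨B, rfl | hB | hB, hv⟩
    · rw [hCv] at hv
      exact hv.imp (fun h => ⟨_, hB₁, h⟩) fun h => ⟨_, hB₂, h⟩
    · exact Or.inl ⟨B, hB.1, hv⟩
    · exact Or.inr ⟨B, hB.1, hv⟩
  · rintro (⟨B, hB, hv⟩ | ⟨B, hB, hv⟩)
    · by_cases hBB : B = B₁
      · exact ⟨C, Or.inl rfl, by rw [hCv]; exact Or.inl (hBB ▸ hv)⟩
      · exact ⟨B, Or.inr (Or.inl ⟨hB, hBB⟩), hv⟩
    · by_cases hBB : B = B₂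
      · exact ⟨C, Or.inl rfl, by rw [hCv]; exact Or.inr (hBB ▸ hv)⟩
      · exact ⟨B, Or.inr (Or.inr ⟨hB, hBB⟩), hv⟩

theorem IsBlockTree.reflTransGen_merge (h₁ : IsBlockTree 𝓑₁) (hB₁ : B₁ ∈ 𝓑₁)
    (hC : IsEvenCycle C) (hCv : C.verts = B₁.verts ∪ B₂.verts) {u v : V}
    (hu : u ∈ (sSup 𝓑₁).verts) (hv : v ∈ (sSup 𝓑₁).verts) :
    ReflTransGen (sSup (insert C (𝓑₁ \ {B₁} ∪ 𝓑₂ \ {B₂}))).Adj u v := by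
  refine reflTransGen_closed ?_ _ _ (linkedIn_univ_iff.1 h₁.linked u hu v hv)
  intro a b hab
  obtain ⟨B, hB, hab⟩ := Subgraph.sSup_adj.1 hab
  by_cases hBB : B = B₁
  · subst hBB
    have hl := linkedIn_univ_iff.1 (nonseparable_coe_iff.1 hC.nonseparable).2.1
    have hsub : B.verts ⊆ C.verts := hCv ▸ Set.subset_union_left
    refine ReflTransGen.mono (fun x y hxy => ?_) _ _
      (hl a (hsub hab.fst_mem) b (hsub hab.snd_mem))
    exact Subgraph.sSup_adj.2 ⟨C, Or.inl rfl, hxy⟩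
  · exact .single (Subgraph.sSup_adj.2 ⟨B, Or.inr (Or.inl ⟨hB, hBB⟩), hab⟩)

theorem IsBlockTree.exists_proj_merge (h₁ : IsBlockTree 𝓑₁)
    (hdisj : Disjoint (sSup 𝓑₁).verts (sSup 𝓑₂).verts) (hB₁ : B₁ ∈ 𝓑₁) (hB₂ : B₂ ∈ 𝓑₂)
    (hCv : C.verts = B₁.verts ∪ B₂.verts) {D : G.Subgraph} (hD : D ∈ 𝓑₁ \ {B₁}) :
    ∃ r : V → V, (∀ v ∈ D.verts, r v = v) ∧
      (∀ v ∈ (sSup (insert C (𝓑₁ \ {B₁} ∪ 𝓑₂ \ {B₂}))).verts, r v ∈ D.verts) ∧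
      ∀ B' ∈ insert C (𝓑₁ \ {B₁} ∪ 𝓑₂ \ {B₂}), B' ≠ D →
        ∀ u ∈ B'.verts, ∀ v ∈ B'.verts, r u = r v := by
  classical
  obtain ⟨r, hrD, hrm, hr⟩ := h₁.exists_proj D hD.1
  obtain ⟨b, hb⟩ := (nonseparable_coe_iff.1 (h₁.isEvenCycle _ hB₁).nonseparable).1
  have hmem₁ : ∀ B ∈ 𝓑₁, ∀ v ∈ B.verts, v ∈ (sSup 𝓑₁).verts :=
    fun B hB v hv => mem_verts_sSup.2 ⟨B, hB, hv⟩
  have hmem₂ : ∀ B ∈ 𝓑₂, ∀ v ∈ B.verts, v ∉ (sSup 𝓑₁).verts :=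
    fun B hB v hv hv' => hdisj.notMem_of_mem_left hv' (mem_verts_sSup.2 ⟨B, hB, hv⟩)
  refine ⟨fun v => if v ∈ (sSup 𝓑₁).verts then r v else r b, fun v hv => ?_, fun v _ => ?_, ?_⟩
  · simp only [hmem₁ D hD.1 v hv, if_true, hrD v hv]
  · dsimp only
    split_ifs with hv
    exacts [hrm v hv, hrm b (hmem₁ _ hB₁ _ hb)]
  · rintro B' (rfl | hB' | hB') hne
    · have key : ∀ u ∈ B'.verts, (if u ∈ (sSup 𝓑₁).verts then r u else r b) = r b := by
        intro u hu
        rw [hCv] at hu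
        rcases hu with hu | hu
        · rw [if_pos (hmem₁ _ hB₁ u hu)]
          exact hr B₁ hB₁ (fun h => hD.2 h.symm) u hu b hb
        · rw [if_neg (hmem₂ _ hB₂ u hu)]
      exact fun u hu v hv => (key u hu).trans (key v hv).symm
    · intro u hu v hv
      simp only [hmem₁ B' hB'.1 u hu, hmem₁ B' hB'.1 v hv, if_true]
      exact hr B' hB'.1 hne u hu v hv
    · intro u hu v hv
      simp only [hmem₂ B' hB'.1 u hu, hmem₂ B' hB'.1 v hv, if_false]

theorem IsBlockTree.mem_at_most_two_merge (h₁ : IsBlockTree 𝓑₁)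
    (hdisj : Disjoint (sSup 𝓑₁).verts (sSup 𝓑₂).verts) (hB₁ : B₁ ∈ 𝓑₁) (hB₂ : B₂ ∈ 𝓑₂)
    (hCv : C.verts = B₁.verts ∪ B₂.verts) {v : V} (hv : v ∈ (sSup 𝓑₁).verts) :
    ∀ D₁ ∈ insert C (𝓑₁ \ {B₁} ∪ 𝓑₂ \ {B₂}), ∀ D₂ ∈ insert C (𝓑₁ \ {B₁} ∪ 𝓑₂ \ {B₂}),
      ∀ D₃ ∈ insert C (𝓑₁ \ {B₁} ∪ 𝓑₂ \ {B₂}), v ∈ D₁.verts → v ∈ D₂.verts →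
      v ∈ D₃.verts → D₁ = D₂ ∨ D₁ = D₃ ∨ D₂ = D₃ := by
  have hmem₂ : ∀ B ∈ 𝓑₂, v ∉ B.verts :=
    fun B hB hv' => hdisj.notMem_of_mem_left hv (mem_verts_sSup.2 ⟨B, hB, hv'⟩)
  have key : ∀ D ∈ insert C (𝓑₁ \ {B₁} ∪ 𝓑₂ \ {B₂}), v ∈ D.verts →
      ∃ D' ∈ 𝓑₁, v ∈ D'.verts ∧ (D = C ∧ D' = B₁ ∨ D' ≠ B₁ ∧ D = D') := by
    rintro D (rfl | hD | hD) hvD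
    · rw [hCv] at hvD
      exact ⟨B₁, hB₁, hvD.resolve_right (hmem₂ B₂ hB₂), Or.inl ⟨rfl, rfl⟩⟩
    · exact ⟨D, hD.1, hvD, Or.inr ⟨hD.2, rfl⟩⟩
    · exact (hmem₂ D hD.1 hvD).elim
  intro D₁ hD₁ D₂ hD₂ D₃ hD₃ hv₁ hv₂ hv₃
  obtain ⟨E₁, hE₁, hvE₁, hDE₁⟩ := key D₁ hD₁ hv₁
  obtain ⟨E₂, hE₂, hvE₂, hDE₂⟩ := key D₂ hD₂ hv₂
  obtain ⟨E₃, hE₃, hvE₃, hDE₃⟩ := key D₃ hD₃ hv₃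
  have := h₁.mem_at_most_two v E₁ hE₁ E₂ hE₂ E₃ hE₃ hvE₁ hvE₂ hvE₃
  clear * - this hDE₁ hDE₂ hDE₃
  grind

/-- Replacing a block `B₁` of one block tree and a block `B₂` of another, disjoint one by a single
even cycle on the union of their vertex sets yields a block tree. -/
theorem IsBlockTree.merge (h₁ : IsBlockTree 𝓑₁) (h₂ : IsBlockTree 𝓑₂)
    (hdisj : Disjoint (sSup 𝓑₁).verts (sSup 𝓑₂).verts) (hB₁ : B₁ ∈ 𝓑₁) (hB₂ : B₂ ∈ 𝓑₂)
    (hC : IsEvenCycle C) (hCv : C.verts = B₁.verts ∪ B₂.verts) :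
    IsBlockTree (insert C (𝓑₁ \ {B₁} ∪ 𝓑₂ \ {B₂})) := by
  have hverts := verts_sSup_merge hB₁ hB₂ hCv
  have hswap : insert C (𝓑₁ \ {B₁} ∪ 𝓑₂ \ {B₂}) = insert C (𝓑₂ \ {B₂} ∪ 𝓑₁ \ {B₁}) := by
    rw [Set.union_comm]
  have hCv' : C.verts = B₂.verts ∪ B₁.verts := by rw [hCv, Set.union_comm]
  refine ⟨?_, ?_, ?_, ?_⟩
  · rintro B (rfl | hB | hB)
    exacts [hC, h₁.isEvenCycle B hB.1, h₂.isEvenCycle B hB.1]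
  · obtain ⟨b₁, hb₁⟩ := (nonseparable_coe_iff.1 (h₁.isEvenCycle _ hB₁).nonseparable).1
    obtain ⟨b₂, hb₂⟩ := (nonseparable_coe_iff.1 (h₂.isEvenCycle _ hB₂).nonseparable).1
    have hs₁ : b₁ ∈ (sSup 𝓑₁).verts := mem_verts_sSup.2 ⟨_, hB₁, hb₁⟩
    have hs₂ : b₂ ∈ (sSup 𝓑₂).verts := mem_verts_sSup.2 ⟨_, hB₂, hb₂⟩
    have hl := linkedIn_univ_iff.1 (nonseparable_coe_iff.1 hC.nonseparable).2.1
    have hb₁C : b₁ ∈ C.verts := hCv ▸ Or.inl hb₁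
    have hb₂C : b₂ ∈ C.verts := hCv ▸ Or.inr hb₂
    have hCle : C.Adj ≤ (sSup (insert C (𝓑₁ \ {B₁} ∪ 𝓑₂ \ {B₂}))).Adj :=
      fun x y hxy => Subgraph.sSup_adj.2 ⟨C, Or.inl rfl, hxy⟩
    have h₁₂ := ReflTransGen.mono hCle _ _ (hl b₁ hb₁C b₂ hb₂C)
    have h₂₁ := ReflTransGen.mono hCle _ _ (hl b₂ hb₂C b₁ hb₁C)
    have key₁ : ∀ {u v}, u ∈ (sSup 𝓑₁).verts → v ∈ (sSup 𝓑₁).verts →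
        ReflTransGen (sSup (insert C (𝓑₁ \ {B₁} ∪ 𝓑₂ \ {B₂}))).Adj u v :=
      h₁.reflTransGen_merge hB₁ hC hCv
    have key₂ : ∀ {u v}, u ∈ (sSup 𝓑₂).verts → v ∈ (sSup 𝓑₂).verts →
        ReflTransGen (sSup (insert C (𝓑₁ \ {B₁} ∪ 𝓑₂ \ {B₂}))).Adj u v := by
      rw [hswap]
      exact h₂.reflTransGen_merge hB₂ hC hCv'
    rw [linkedIn_univ_iff, hverts]
    rintro u (hu | hu) w (hw | hw)
    · exact key₁ hu hw
    · exact (key₁ hu hs₁).trans (h₁₂.trans (key₂ hs₂ hw))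
    · exact (key₂ hu hs₂).trans (h₂₁.trans (key₁ hs₁ hw))
    · exact key₂ hu hw
  · rintro D (rfl | hD | hD)
    · classical
      obtain ⟨r₁, hr₁, hm₁, hc₁⟩ := h₁.exists_proj B₁ hB₁
      obtain ⟨r₂, hr₂, hm₂, hc₂⟩ := h₂.exists_proj B₂ hB₂
      have hin₁ : ∀ B ∈ 𝓑₁, ∀ v ∈ B.verts, v ∈ (sSup 𝓑₁).verts :=
        fun B hB v hv => mem_verts_sSup.2 ⟨B, hB, hv⟩
      have hin₂ : ∀ B ∈ 𝓑₂, ∀ v ∈ B.verts, v ∉ (sSup 𝓑₁).verts :=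
        fun B hB v hv hv' => hdisj.notMem_of_mem_left hv' (mem_verts_sSup.2 ⟨B, hB, hv⟩)
      rw [hverts, hCv]
      refine ⟨fun v => if v ∈ (sSup 𝓑₁).verts then r₁ v else r₂ v, ?_, ?_, ?_⟩
      · rintro v (hv | hv)
        · simp only [hin₁ _ hB₁ v hv, if_true, hr₁ v hv]
        · simp only [hin₂ _ hB₂ v hv, if_false, hr₂ v hv]
      · intro v hv
        dsimp only
        split_ifs with hv₁
        exacts [Or.inl (hm₁ v hv₁), Or.inr (hm₂ v (hv.resolve_left hv₁))]
      · rintro B' (rfl | hB' | hB') hne u hu v hv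
        · exact (hne rfl).elim
        · simp only [hin₁ B' hB'.1 u hu, hin₁ B' hB'.1 v hv, if_true]
          exact hc₁ B' hB'.1 hB'.2 u hu v hv
        · simp only [hin₂ B' hB'.1 u hu, hin₂ B' hB'.1 v hv, if_false]
          exact hc₂ B' hB'.1 hB'.2 u hu v hv
    · exact h₁.exists_proj_merge hdisj hB₁ hB₂ hCv hD
    · rw [hswap]
      exact h₂.exists_proj_merge hdisj.symm hB₂ hB₁ hCv' hD
  · intro v D₁ hD₁ D₂ hD₂ D₃ hD₃ hv₁ hv₂ hv₃
    have hv : v ∈ (sSup (insert C (𝓑₁ \ {B₁} ∪ 𝓑₂ \ {B₂}))).verts :=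
      mem_verts_sSup.2 ⟨D₁, hD₁, hv₁⟩
    rw [hverts] at hv
    rcases hv with hv | hv
    · exact h₁.mem_at_most_two_merge hdisj hB₁ hB₂ hCv hv D₁ hD₁ D₂ hD₂ D₃ hD₃ hv₁ hv₂ hv₃
    · rw [hswap] at hD₁ hD₂ hD₃
      exact h₂.mem_at_most_two_merge hdisj.symm hB₂ hB₁ hCv' hv D₁ hD₁ D₂ hD₂ D₃ hD₃ hv₁ hv₂ hv₃

end Merge

/-- An even cycle can be numbered starting at one end of a given edge and finishing at the
other end. -/
theorem IsEvenCycle.exists_iso {G : SimpleGraph V} {B : G.Subgraph} (h : IsEvenCycle B) {x y : V}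
    (hxy : B.Adj x y) : ∃ k : ℕ, ∃ e : cycleGraph (2 * k + 2) ≃g B.coe,
      (e 0 : V) = x ∧ (e (Fin.last _) : V) = y := by
  obtain ⟨k, ⟨e⟩⟩ := h
  refine ⟨k, ?_⟩
  set i := e ⟨x, hxy.fst_mem⟩ with hi
  set j := e ⟨y, hxy.snd_mem⟩ with hj
  have hei : e.symm i = ⟨x, hxy.fst_mem⟩ := by simp [hi]
  have hej : e.symm j = ⟨y, hxy.snd_mem⟩ := by simp [hj]
  have hlast : (Fin.last (2 * k + 1)) = -1 := by
    rw [eq_neg_iff_add_eq_zero, Fin.last_add_one]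
  have hij : (cycleGraph (2 * k + 2)).Adj i j := e.map_adj_iff.2 hxy
  rw [cycleGraph_adj] at hij
  rcases hij with hij | hij
  · let f : cycleGraph (2 * k + 2) ≃g cycleGraph (2 * k + 2) :=
      ⟨Equiv.addLeft i, by intro a b; simp [cycleGraph_adj]⟩
    refine ⟨f.trans e.symm, ?_, ?_⟩
    · show (e.symm (i + 0)).1 = x
      rw [add_zero, hei]
    · show (e.symm (i + Fin.last _)).1 = y
      rw [hlast, ← hij, show i + -(i - j) = j by abel, hej]
  · let f : cycleGraph (2 * k + 2) ≃g cycleGraph (2 * k + 2) :=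
      ⟨Equiv.subLeft i, by intro a b; simp [cycleGraph_adj, or_comm]⟩
    refine ⟨f.trans e.symm, ?_, ?_⟩
    · show (e.symm (i - 0)).1 = x
      rw [sub_zero, hei]
    · show (e.symm (i - Fin.last _)).1 = y
      rw [hlast, ← hij, show i - -(j - i) = j by abel, hej]

theorem cycleGraph_adj_iff_val {n : ℕ} {u v : Fin (n + 2)} :
    (cycleGraph (n + 2)).Adj u v ↔ u.val + 1 = v.val ∨ v.val + 1 = u.val ∨
      (u.val = 0 ∧ v.val = n + 1) ∨ (v.val = 0 ∧ u.val = n + 1) := by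
  have key : ∀ a b : Fin (n + 2), (a - b).val = 1 ↔
      b.val + 1 = a.val ∨ (a.val = 0 ∧ b.val = n + 1) := by
    intro a b
    have ha := a.isLt
    have hb := b.isLt
    rcases le_or_gt b a with h | h
    · rw [Fin.sub_val_of_le h]
      have := Fin.le_def.1 h
      omega
    · have := Fin.lt_def.1 h
      rw [Fin.sub_def]
      show (n + 2 - b.val + a.val) % (n + 2) = 1 ↔ _
      rw [Nat.mod_eq_of_lt (by omega)]
      omega
  rw [cycleGraph_adj', key, key]
  tauto

/-- Two disjoint even cycles through the opposite edges `x₁y₁` and `x₂y₂` of a 4-cycle can be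
replaced by one even cycle. -/
theorem IsEvenCycle.exists_merge {G : SimpleGraph V} {B₁ B₂ : G.Subgraph} (h₁ : IsEvenCycle B₁)
    (h₂ : IsEvenCycle B₂) (hdisj : Disjoint B₁.verts B₂.verts) {x₁ y₁ x₂ y₂ : V}
    (he₁ : B₁.Adj x₁ y₁) (he₂ : B₂.Adj x₂ y₂) (hg₁ : G.Adj x₁ y₂) (hg₂ : G.Adj x₂ y₁) :
    ∃ C : G.Subgraph, IsEvenCycle C ∧ C.verts = B₁.verts ∪ B₂.verts := by
  obtain ⟨k, e, hex, hey⟩ := h₁.exists_iso he₁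
  obtain ⟨l, f, hfx, hfy⟩ := h₂.exists_iso he₂
  let g : Fin (2 * (k + l + 1) + 2) → V := fun t =>
    if h : t.val < 2 * k + 2 then (e ⟨t.val, h⟩).1
    else (f ⟨t.val - (2 * k + 2), by have := t.isLt; omega⟩).1
  have hge : ∀ t (h : t.val < 2 * k + 2), g t = (e ⟨t.val, h⟩).1 := fun t h => dif_pos h
  have hgf : ∀ t (h : ¬ t.val < 2 * k + 2),
      g t = (f ⟨t.val - (2 * k + 2), by have := t.isLt; omega⟩).1 := fun t h => dif_neg h
  have hadj : ∀ s t : Fin (2 * (k + l + 1) + 2), s.val + 1 = t.val → G.Adj (g s) (g t) := by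
    intro s t hst
    by_cases ht : t.val < 2 * k + 2
    · rw [hge s (by omega), hge t ht]
      refine B₁.adj_sub (e.map_adj_iff.2 (cycleGraph_adj_iff_val.2 ?_))
      exact Or.inl hst
    · by_cases hs : s.val < 2 * k + 2
      · have hgs : g s = y₁ := by
          rw [hge s hs, ← hey]
          congr 2
          ext
          simp
          omega
        have hgt : g t = x₂ := by
          rw [hgf t ht, ← hfx]
          congr 2
          ext
          simp
          omega
        rw [hgs, hgt]
        exact hg₂.symm
      · rw [hgf s hs, hgf t ht]
        refine B₂.adj_sub (f.map_adj_iff.2 (cycleGraph_adj_iff_val.2 ?_))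
        left
        simp only
        omega
  have hend : ∀ s t : Fin (2 * (k + l + 1) + 2), s.val = 0 → t.val = 2 * (k + l + 1) + 1 →
      G.Adj (g s) (g t) := by
    intro s t hs ht
    have hgs : g s = x₁ := by
      rw [hge s (by omega), ← hex]
      congr 2
      ext
      simp [hs]
    have hgt : g t = y₂ := by
      rw [hgf t (by omega), ← hfy]
      congr 2
      ext
      simp
      omega
    rw [hgs, hgt]
    exact hg₁
  have hne : ∀ a b, (e a).1 ≠ (f b).1 := fun a b h =>
    hdisj.notMem_of_mem_left (e a).2 (h ▸ (f b).2)
  have hinj : Function.Injective g := by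
    intro s t hst
    by_cases hs : s.val < 2 * k + 2 <;> by_cases ht : t.val < 2 * k + 2
    · rw [hge s hs, hge t ht] at hst
      have := e.injective (Subtype.ext hst)
      rw [Fin.ext_iff] at this ⊢
      exact this
    · rw [hge s hs, hgf t ht] at hst
      exact (hne _ _ hst).elim
    · rw [hgf s hs, hge t ht] at hst
      exact (hne _ _ hst.symm).elim
    · rw [hgf s hs, hgf t ht] at hst
      have := f.injective (Subtype.ext hst)
      rw [Fin.ext_iff] at this ⊢
      simp only at this
      omega
  let φ : (cycleGraph (2 * (k + l + 1) + 2)).Copy G := ⟨⟨g, by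
    intro s t hst
    rcases cycleGraph_adj_iff_val.1 hst with h | h | h | h
    · exact hadj s t h
    · exact (hadj t s h).symm
    · exact hend s t h.1 h.2
    · exact (hend t s h.1 h.2).symm⟩, hinj⟩
  refine ⟨φ.toSubgraph, ⟨k + l + 1, ⟨φ.isoToSubgraph.symm⟩⟩, ?_⟩
  ext v
  constructor
  · rintro ⟨t, -, rfl⟩
    show g t ∈ _
    by_cases ht : t.val < 2 * k + 2
    · rw [hge t ht]
      exact Or.inl (e _).2
    · rw [hgf t ht]
      exact Or.inr (f _).2
  · rintro (hv | hv)
    · refine ⟨⟨(e.symm ⟨v, hv⟩).val, by omega⟩, trivial, ?_⟩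
      show g _ = v
      rw [hge _ (e.symm ⟨v, hv⟩).isLt]
      simp
    · refine ⟨⟨(f.symm ⟨v, hv⟩).val + (2 * k + 2), by omega⟩, trivial, ?_⟩
      show g _ = v
      rw [hgf _ (by simp)]
      simp

/-- Two vertex-disjoint SBEP subgraphs of `G`, with edges
`x₁y₁`, `x₂y₂` such that `x₁y₂, x₂y₁ ∈ E(G)`, can be combined into one SBEP
subgraph of `G` covering the union of their vertex sets. -/
theorem stmt_4 {V : Type*} [Fintype V] (G : SimpleGraph V) (H₁ H₂ : G.Subgraph)
    (hdisj : Disjoint H₁.verts H₂.verts) (h₁ : IsSBEP H₁.coe) (h₂ : IsSBEP H₂.coe)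
    (x₁ y₁ x₂ y₂ : V) (he₁ : H₁.Adj x₁ y₁) (he₂ : H₂.Adj x₂ y₂)
    (hg₁ : G.Adj x₁ y₂) (hg₂ : G.Adj x₂ y₁) :
    ∃ H : G.Subgraph, IsSBEP H.coe ∧ H.verts = H₁.verts ∪ H₂.verts := by
  obtain ⟨𝓑₁, ht₁, rfl⟩ := exists_isBlockTree h₁
  obtain ⟨𝓑₂, ht₂, rfl⟩ := exists_isBlockTree h₂
  obtain ⟨B₁, hB₁, hadj₁⟩ := Subgraph.sSup_adj.1 he₁
  obtain ⟨B₂, hB₂, hadj₂⟩ := Subgraph.sSup_adj.1 he₂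
  obtain ⟨C, hC, hCv⟩ := (ht₁.isEvenCycle B₁ hB₁).exists_merge (ht₂.isEvenCycle B₂ hB₂)
    (hdisj.mono (le_sSup hB₁).1 (le_sSup hB₂).1) hadj₁ hadj₂ hg₁ hg₂
  have hverts := verts_sSup_merge hB₁ hB₂ hCv
  exact ⟨_, (ht₁.merge ht₂ hdisj hB₁ hB₂ hC hCv).isSBEP
    (hverts ▸ ⟨x₁, Or.inl he₁.fst_mem⟩), hverts⟩
end

section
/- Every SBEP graph G is prism-hamiltonian, i.e., the Cartesian product G □ K2 has a Hamiltonian cycle. -/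
open SimpleGraph

variable {V : Type*} {W : Type*}

/-- Two consecutive entries of a cyclic list that avoid the two distinguished entries `a`, `b`
are consecutive in the remaining part. -/
theorem exists_infix_of_isRotated {α : Type*} {a b x y : α} {m k : List α}
    (h : (a :: b :: m) ~r (x :: y :: k)) (hxa : x ≠ a) (hxb : x ≠ b) (hya : y ≠ a) :
    ∃ p q, m = p ++ x :: y :: q := by
  obtain ⟨n, h⟩ := h
  rw [List.rotate_eq_drop_append_take_mod] at h
  generalize n % (a :: b :: m).length = n at h
  rcases n with _ | _ | n
  · grind
  · grind
  · refine ⟨m.take n, (m.drop n).drop 2, ?_⟩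
    simp only [List.drop_succ_cons, List.take_succ_cons] at h
    rcases h2 : m.drop n with _ | ⟨c, _ | ⟨d, e⟩⟩
    · grind
    · grind
    · have := List.take_append_drop n m
      grind

/-- Two cycles that traverse the same edge in opposite directions can be merged into one cycle
avoiding this edge. -/
theorem cycle_chain_merge {α : Type*} {r : α → α → Prop} {a b : α} {m m' : List α}
    (h : Cycle.Chain r (↑(a :: b :: m) : Cycle α))
    (h' : Cycle.Chain r (↑(b :: a :: m') : Cycle α)) :
    Cycle.Chain r (↑(a :: m' ++ b :: m) : Cycle α) := by
  simp only [Cycle.chain_coe_cons, List.cons_append] at *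
  have := (List.isChain_split (c := b) (l₁ := a :: m') (l₂ := m ++ [a])).2 ⟨h'.of_cons, h.of_cons⟩
  simpa using this

theorem cycle_coe_append_infix {α : Type*} {x y : α} (s p q t : List α) :
    ∃ k, (↑(s ++ (p ++ x :: y :: q) ++ t) : Cycle α) = (↑(x :: y :: k) : Cycle α) := by
  refine ⟨q ++ t ++ s ++ p, ?_⟩
  rw [Cycle.coe_eq_coe]
  simpa using List.isRotated_append (l := s ++ p) (l' := x :: y :: q ++ t)

theorem hasHamCycle_of_cycle {α : Type*} [DecidableEq α] {G : SimpleGraph α} {c : Cycle α}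
    (hn : c.Nodup) (hc : c.Chain G.Adj) (hm : ∀ x, x ∈ c) {a b d : α} (hab : a ≠ b) (had : a ≠ d)
    (hbd : b ≠ d) : HasHamCycle G := by
  induction c using Quotient.inductionOn with | _ l
  change (l : Cycle α).Nodup at hn
  change (l : Cycle α).Chain _ at hc
  change ∀ x, x ∈ (l : Cycle α) at hm
  simp only [Cycle.nodup_coe_iff, Cycle.mem_coe_iff] at hn hm
  match l with
  | [] => simpa using hm a
  | [x] => have := hm a; have := hm b; grind
  | [x, y] => have := hm a; have := hm b; have := hm d; grind
  | x :: y :: z :: l =>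
    rw [Cycle.chain_coe_cons] at hc
    let w := (Walk.ofSupport _ (by simp) hc).copy (u' := x) (v' := x) rfl (by simp)
    have hw : w.support = x :: y :: z :: l ++ [x] :=
      (Walk.support_copy _ _ _).trans (Walk.support_ofSupport _ _)
    have hlen : w.length + 1 = l.length + 4 := by
      rw [← Walk.length_support, hw]; simp
    have hnil : ¬ w.Nil := by
      rw [← Walk.length_eq_zero_iff]; omega
    have ht : w.tail.support = y :: z :: l ++ [x] := by
      rw [Walk.support_tail_of_not_nil _ hnil, hw]; simp
    have hp : w.tail.IsPath := by
      rw [Walk.isPath_def, ht]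
      grind
    refine ⟨x, w, ?_⟩
    rw [Walk.isHamiltonianCycle_isCycle_and_isHamiltonian_tail,
      Walk.isCycle_iff_isPath_tail_and_le_length]
    refine ⟨⟨hp, by omega⟩, hp.isHamiltonian_of_mem fun v => ?_⟩
    rw [ht]
    have := hm v
    grind

/-- The vertical zigzag in the prism along a list of vertices. -/
def zigzag (i : Fin 2) : List V → List (V × Fin 2)
  | [] => []
  | v :: l => (v, i) :: (v, i.rev) :: zigzag i.rev l

theorem fin_two_eq_or_rev (i j : Fin 2) : j = i ∨ j = i.rev := by
  revert i j; decide

theorem fin_two_ne_rev (i : Fin 2) : i ≠ i.rev := by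
  revert i; decide

theorem prism_adj_rev (G : SimpleGraph V) (v : V) (i : Fin 2) :
    (prism G).Adj (v, i) (v, i.rev) := by
  simp [prism, boxProd_adj, fin_two_ne_rev]

theorem prism_adj_of_adj {G : SimpleGraph V} {u v : V} (h : G.Adj u v) (i : Fin 2) :
    (prism G).Adj (u, i) (v, i) := by
  simp [prism, boxProd_adj, h]

theorem mem_zigzag {l : List V} {i : Fin 2} {x : V × Fin 2} : x ∈ zigzag i l ↔ x.1 ∈ l := by
  induction l generalizing i with
  | nil => simp [zigzag]
  | cons v l ih =>
    obtain ⟨w, j⟩ := x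
    have := fin_two_eq_or_rev i j
    simp only [zigzag, List.mem_cons, ih, Prod.mk.injEq]
    tauto

theorem nodup_zigzag {l : List V} (h : l.Nodup) (i : Fin 2) : (zigzag i l).Nodup := by
  induction l generalizing i with
  | nil => simp [zigzag]
  | cons v l ih =>
    rw [List.nodup_cons] at h
    simp [zigzag, mem_zigzag, h.1, ih h.2, fin_two_ne_rev]

theorem zigzag_append (l l' : List V) (hl : Even l.length) (i : Fin 2) :
    zigzag i (l ++ l') = zigzag i l ++ zigzag i l' := by
  match l with
  | [] => rfl
  | [_] => simp at hl
  | u :: v :: l =>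
    have : Even l.length := by simpa [Nat.even_add_one] using hl
    simp [zigzag, zigzag_append l l' this]

theorem isChain_zigzag {G : SimpleGraph V} {l : List V} (h : l.IsChain G.Adj) (i : Fin 2) :
    (zigzag i l).IsChain (prism G).Adj := by
  induction l generalizing i with
  | nil => simp [zigzag]
  | cons v l ih =>
    cases l with
    | nil => simp [zigzag, prism_adj_rev]
    | cons w l =>
      rw [List.isChain_cons_cons] at h
      have := ih h.2 i.rev
      simp only [zigzag] at this ⊢
      exact .cons_cons (prism_adj_rev ..) (.cons_cons (prism_adj_of_adj h.1 _) this)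

theorem chain_zigzag {G : SimpleGraph V} {v : V} {l : List V} (hl : Even (v :: l).length)
    (h : (v :: l ++ [v]).IsChain G.Adj) :
    Cycle.Chain (prism G).Adj (↑(zigzag 0 (v :: l)) : Cycle (V × Fin 2)) := by
  have := isChain_zigzag h 0
  rw [zigzag_append _ _ hl] at this
  simp only [zigzag] at this ⊢
  rw [Cycle.chain_coe_cons]
  rw [show ∀ s : List (V × Fin 2), s ++ [(v, (0 : Fin 2)), (v, Fin.rev 0)] =
    (s ++ [(v, 0)]) ++ [(v, Fin.rev 0)] by simp] at this
  exact this.left_of_append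

theorem zigzag_vertical {l : List V} {v : V} (hv : v ∈ l) (i : Fin 2) :
    ∃ j p q, zigzag i l = p ++ (v, j) :: (v, j.rev) :: q := by
  induction l generalizing i with
  | nil => simp at hv
  | cons w l ih =>
    by_cases h : v = w
    · subst h
      exact ⟨i, [], zigzag i.rev l, rfl⟩
    · obtain ⟨j, p, q, hq⟩ := ih (by simpa [h] using hv) i.rev
      exact ⟨j, (w, i) :: (w, i.rev) :: p, q, by simp [zigzag, hq]⟩

/-- Reachability inside the subgraph `B` along vertices outside `s`. -/
def Avoids {G : SimpleGraph V} (B : G.Subgraph) (s : Set V) : V → V → Prop :=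
  Relation.ReflTransGen fun a b => B.Adj a b ∧ a ∉ s ∧ b ∉ s

/-- `B` is nonempty and stays connected after deleting at most one vertex. -/
def IsNonsep {G : SimpleGraph V} (B : G.Subgraph) : Prop :=
  B.verts.Nonempty ∧ ∀ s : Set V, s.Subsingleton →
    ∀ a ∈ B.verts, ∀ b ∈ B.verts, a ∉ s → b ∉ s → Avoids B s a b

section Blocks

variable {G : SimpleGraph V} {B C : G.Subgraph} {s : Set V}

theorem Avoids.mono (h : B ≤ C) {a b : V} (hab : Avoids B s a b) : Avoids C s a b :=
  Relation.ReflTransGen.mono (fun _ _ hx => ⟨h.2 hx.1, hx.2⟩) _ _ hab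

theorem Avoids.symm {a b : V} (hab : Avoids B s a b) : Avoids B s b a :=
  haveI : Std.Symm fun a b => B.Adj a b ∧ a ∉ s ∧ b ∉ s :=
    ⟨fun _ _ hx => ⟨hx.1.symm, hx.2.2, hx.2.1⟩⟩
  Relation.ReflTransGen.stdSymm.symm _ _ hab

theorem coe_connected_iff :
    B.coe.Connected ↔ B.verts.Nonempty ∧ ∀ a ∈ B.verts, ∀ b ∈ B.verts, Avoids B ∅ a b := by
  rw [connected_iff, Set.nonempty_coe_sort, and_comm]
  refine and_congr_right fun _ => ⟨fun h a ha b hb => ?_, fun h => ?_⟩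
  · exact Relation.ReflTransGen.lift Subtype.val (fun x y hxy => ⟨hxy, by simp, by simp⟩) _ _
      ((reachable_iff_reflTransGen _ _).1 (h ⟨a, ha⟩ ⟨b, hb⟩))
  · rintro ⟨a, ha⟩ ⟨b, hb⟩
    have := h a ha b hb
    induction this with
    | refl => rfl
    | @tail x y _ hxy ih =>
      exact (ih hxy.1.fst_mem).trans (Adj.reachable (G := B.coe) hxy.1)

theorem not_isCutvertex_iff {v : B.verts} :
    ¬ IsCutvertex B.coe v ↔ ∀ a ∈ B.verts, ∀ b ∈ B.verts, a ≠ v.1 → b ≠ v.1 →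
      Avoids B {v.1} a b := by
  rw [IsCutvertex, not_not]
  refine ⟨fun h a ha b hb hav hbv => ?_, fun h => ?_⟩
  · have hr := h ⟨⟨a, ha⟩, fun h => hav (congrArg Subtype.val h)⟩
      ⟨⟨b, hb⟩, fun h => hbv (congrArg Subtype.val h)⟩
    rw [reachable_iff_reflTransGen] at hr
    exact Relation.ReflTransGen.lift (r := (B.coe.induce {v}ᶜ).Adj)
      (fun x => x.1.1) (fun x y hxy =>
      ⟨hxy, fun h => x.2 (Subtype.ext h), fun h => y.2 (Subtype.ext h)⟩) _ _ hr
  · rintro ⟨⟨a, ha⟩, ha'⟩ ⟨⟨b, hb⟩, hb'⟩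
    have := h a ha b hb (fun h => ha' (Subtype.ext h)) (fun h => hb' (Subtype.ext h))
    induction this with
    | refl => rfl
    | @tail x y _ hxy ih =>
      exact (ih hxy.1.fst_mem (fun h => hxy.2.1 (congrArg Subtype.val h))).trans
        (Adj.reachable (G := B.coe.induce _) hxy.1)

theorem isNonsep_iff : IsNonsep B ↔ B.coe.Connected ∧ ∀ v, ¬ IsCutvertex B.coe v := by
  simp only [coe_connected_iff, not_isCutvertex_iff]
  constructor
  · rintro ⟨h, h'⟩
    exact ⟨⟨h, fun a ha b hb => h' ∅ (by simp) a ha b hb (by simp) (by simp)⟩,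
      fun v a ha b hb hav hbv => h' {v.1} (by simp) a ha b hb hav hbv⟩
  · rintro ⟨⟨h, h₀⟩, h₁⟩
    refine ⟨h, fun s hs a ha b hb has hbs => ?_⟩
    rcases hs.eq_empty_or_singleton with rfl | ⟨v, rfl⟩
    · exact h₀ a ha b hb
    · by_cases hv : v ∈ B.verts
      · exact h₁ ⟨v, hv⟩ a ha b hb has hbs
      · refine Relation.ReflTransGen.mono (fun x y hxy => ⟨hxy.1, ?_, ?_⟩) _ _ (h₀ a ha b hb)
        · rintro rfl; exact hv hxy.1.fst_mem
        · rintro rfl; exact hv hxy.1.snd_mem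

theorem isBlock_iff_s5 : IsBlock G B ↔ Maximal IsNonsep B := by
  simp only [IsBlock, maximal_iff, isNonsep_iff, and_assoc, and_imp]
  refine and_congr_right fun _ => and_congr_right fun _ => ⟨fun h B' h₁ h₂ h₃ => ?_,
    fun h B' h₁ h₂ h₃ => ?_⟩
  · exact (h B' h₃ h₁ h₂).symm
  · exact (h h₂ h₃ h₁).symm

theorem IsBlock.isNonsep (h : IsBlock G B) : IsNonsep B := (isBlock_iff_s5.1 h).prop

theorem exists_isBlock_ge [Finite V] (h : IsNonsep B) : ∃ C, B ≤ C ∧ IsBlock G C := by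
  simpa only [isBlock_iff_s5] using Finite.exists_le_maximal h

/-- A block contains every subgraph all of whose vertices can be linked to the block in spite of
the deletion of a vertex. -/
theorem IsBlock.ge_of_linked (h : IsBlock G B) {Q : G.Subgraph}
    (hQ : ∀ s : Set V, s.Subsingleton → ∀ q ∈ Q.verts, q ∉ s →
      ∃ b ∈ B.verts, b ∉ s ∧ Avoids Q s q b) : Q ≤ B := by
  have key : IsNonsep (B ⊔ Q) := by
    refine ⟨h.isNonsep.1.mono (by simp), fun s hs => ?_⟩
    have link : ∀ a ∈ (B ⊔ Q).verts, a ∉ s → ∃ b ∈ B.verts, b ∉ s ∧ Avoids (B ⊔ Q) s a b := by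
      rintro a (ha | ha) has
      · exact ⟨a, ha, has, .refl⟩
      · obtain ⟨b, hb, hbs, hab⟩ := hQ s hs a ha has
        exact ⟨b, hb, hbs, hab.mono le_sup_right⟩
    intro a ha b hb has hbs
    obtain ⟨a', ha', has', haa⟩ := link a ha has
    obtain ⟨b', hb', hbs', hbb⟩ := link b hb hbs
    exact (haa.trans ((h.isNonsep.2 s hs a' ha' b' hb' has' hbs').mono le_sup_left)).trans hbb.symm
  exact le_sup_right.trans ((isBlock_iff_s5.1 h).le_of_ge key le_sup_left)

theorem IsBlock.eq_of_two_common (hB : IsBlock G B) (hC : IsBlock G C) {u v : V} (huv : u ≠ v)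
    (hu : u ∈ B.verts) (hv : v ∈ B.verts) (hu' : u ∈ C.verts) (hv' : v ∈ C.verts) : B = C := by
  have hle : C ≤ B := hB.ge_of_linked fun s hs q hq hqs => by
    by_cases h : u ∈ s
    · have hvs : v ∉ s := fun h' => huv (hs h h')
      exact ⟨v, hv, hvs, hC.isNonsep.2 s hs q hq v hv' hqs hvs⟩
    · exact ⟨u, hu, h, hC.isNonsep.2 s hs q hq u hu' hqs h⟩
  exact ((isBlock_iff_s5.1 hC).eq_of_le hB.isNonsep hle).symm

theorem avoids_toSubgraph {u v : V} (p : G.Walk u v) {B : G.Subgraph} (hp : p.toSubgraph ≤ B)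
    (hs : ∀ x ∈ p.support, x ∉ s) : Avoids B s u v := by
  induction p with
  | nil => exact .refl
  | cons h p ih =>
    simp only [Walk.toSubgraph, sup_le_iff] at hp
    refine .head ⟨hp.1.2 (by simp), hs _ (by simp), hs _ (by simp)⟩ (ih hp.2 fun x hx => ?_)
    exact hs _ (by simp [hx])

theorem IsBlock.toSubgraph_le (hB : IsBlock G B) {u v : V} (hu : u ∈ B.verts) (hv : v ∈ B.verts)
    {p : G.Walk u v} (hp : p.IsPath) : p.toSubgraph ≤ B := by
  classical
  refine hB.ge_of_linked fun s hs q hq hqs => ?_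
  have hq' : q ∈ p.support := by simpa using hq
  have hle₁ : (p.takeUntil q hq').toSubgraph ≤ p.toSubgraph := by
    conv_rhs => rw [← p.take_spec hq', Walk.toSubgraph_append]
    exact le_sup_left
  have hle₂ : (p.dropUntil q hq').toSubgraph ≤ p.toSubgraph := by
    conv_rhs => rw [← p.take_spec hq', Walk.toSubgraph_append]
    exact le_sup_right
  by_cases h : ∀ x ∈ (p.takeUntil q hq').support, x ∉ s
  · exact ⟨u, hu, h _ (by simp), (avoids_toSubgraph _ hle₁ h).symm⟩
  · push Not at h
    obtain ⟨x, hx, hxs⟩ := h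
    have h' : ∀ y ∈ (p.dropUntil q hq').support, y ∉ s := by
      intro y hy hys
      obtain rfl := hs hxs hys
      have hxq : x ≠ q := fun h => hqs (h ▸ hxs)
      have hn := hp.support_nodup
      rw [← p.take_spec hq', Walk.support_append, List.nodup_append] at hn
      rw [← Walk.cons_tail_support] at hy
      have hy' := (List.mem_cons.1 hy).resolve_left hxq
      exact hn.2.2 _ hx _ hy' rfl
    exact ⟨v, hv, h' _ (by simp), avoids_toSubgraph _ hle₂ h'⟩

theorem isNonsep_subgraphOfAdj {u v : V} (h : G.Adj u v) : IsNonsep (G.subgraphOfAdj h) := by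
  refine ⟨⟨u, by simp⟩, fun s hs a ha b hb has hbs => ?_⟩
  by_cases hab : a = b
  · subst hab; exact .refl
  · refine .single ⟨?_, has, hbs⟩
    simp only [subgraphOfAdj_verts, Set.mem_insert_iff, Set.mem_singleton_iff] at ha hb
    simp only [subgraphOfAdj_adj, Sym2.eq_iff]
    grind

theorem isNonsep_singletonSubgraph (v : V) : IsNonsep (G.singletonSubgraph v) := by
  refine ⟨⟨v, by simp⟩, fun s hs a ha b hb has hbs => ?_⟩
  obtain rfl : a = v := by simpa using ha
  obtain rfl : b = a := by simpa using hb
  exact .refl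

/-- If the union of a family of blocks is connected, any further block meets it in at most one
vertex. -/
theorem IsBlock.subsingleton_inter {F : Set G.Subgraph} (hF : ∀ C ∈ F, IsBlock G C)
    (hconn : (sSup F).Connected) (hB : IsBlock G B) (hBF : B ∉ F) :
    (B.verts ∩ (sSup F).verts).Subsingleton := by
  rintro u ⟨huB, huF⟩ w ⟨hwB, hwF⟩
  by_contra huw
  obtain ⟨p, hp⟩ := (hconn.coe.preconnected ⟨u, huF⟩ ⟨w, hwF⟩).exists_isPath
  have hle := hB.toSubgraph_le (p := p.map (sSup F).hom) huB hwB
    (hp.map (Subgraph.hom_injective))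
  cases p with
  | nil => exact huw rfl
  | @cons _ x _ h p =>
    obtain ⟨C, hC, hadj⟩ := Subgraph.sSup_adj.1 h
    have hBadj : B.Adj u x := hle.2 (Or.inl rfl)
    exact hBF (hB.eq_of_two_common (hF C hC) hadj.ne hBadj.fst_mem hBadj.snd_mem hadj.fst_mem
      hadj.snd_mem ▸ hC)

end Blocks

/-- `c` is a cyclic enumeration of `S × Fin 2` forming a closed trail in the prism over `G` which
uses the vertical edge over each vertex of `T`. -/
structure IsPrismCycle (G : SimpleGraph V) (S T : Set V) (c : Cycle (V × Fin 2)) : Prop where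
  nodup : c.Nodup
  chain : c.Chain (prism G).Adj
  mem_iff : ∀ x, x ∈ c ↔ x.1 ∈ S
  vertical : ∀ v ∈ T, ∃ (j : Fin 2) (m : _), c = (↑((v, j) :: (v, j.rev) :: m) : Cycle (V × Fin 2))

theorem cycle_chain_reverse {α : Type*} {r : α → α → Prop} (hr : ∀ x y, r x y → r y x) {c : Cycle α}
    (h : c.Chain r) : c.reverse.Chain r := by
  induction c using Quotient.inductionOn with | _ l
  change (l : Cycle α).Chain r at h
  change (l : Cycle α).reverse.Chain r
  cases l with
  | nil => simp
  | cons a l =>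
    have : (↑(a :: l) : Cycle α).reverse = (↑(a :: l.reverse) : Cycle α) := by
      rw [Cycle.reverse_coe, Cycle.coe_eq_coe, List.reverse_cons]
      exact List.isRotated_append
    rw [this, Cycle.chain_coe_cons]
    rw [Cycle.chain_coe_cons] at h
    have h' : (a :: (l ++ [a])).reverse.IsChain r :=
      List.isChain_reverse.2 (h.imp fun _ _ hxy => hr _ _ hxy)
    simpa using h'

section PrismCycle

variable {G : SimpleGraph V} {S T S' T' : Set V} {c c' : Cycle (V × Fin 2)}

theorem IsPrismCycle.reverse (h : IsPrismCycle G S T c) : IsPrismCycle G S T c.reverse where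
  nodup := Cycle.nodup_reverse_iff.2 h.nodup
  chain := cycle_chain_reverse (fun _ _ => Adj.symm) h.chain
  mem_iff x := by rw [Cycle.mem_reverse_iff, h.mem_iff]
  vertical v hv := by
    obtain ⟨j, m, rfl⟩ := h.vertical v hv
    refine ⟨j.rev, m.reverse, ?_⟩
    rw [Cycle.reverse_coe, Cycle.coe_eq_coe]
    simpa using List.isRotated_append (l := m.reverse) (l' := [(v, j.rev), (v, j)])

theorem IsPrismCycle.exists_infix {u v : V} {i : Fin 2} {m : List (V × Fin 2)}
    (h : IsPrismCycle G S T (↑((u, i) :: (u, i.rev) :: m) : Cycle (V × Fin 2)))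
    (hv : v ∈ T) (hvu : v ≠ u) : ∃ j p q, m = p ++ (v, j) :: (v, j.rev) :: q := by
  obtain ⟨j, k, hk⟩ := h.vertical v hv
  obtain ⟨p, q, h⟩ := exists_infix_of_isRotated (Cycle.coe_eq_coe.1 hk) (by simp [hvu])
    (by simp [hvu]) (by simp [hvu])
  exact ⟨j, p, q, h⟩

/-- Cycles in the prisms over two vertex sets sharing a single vertex `u` can be merged along the
vertical edge over `u`. -/
theorem IsPrismCycle.merge {u : V} (h : IsPrismCycle G S T c) (h' : IsPrismCycle G S' T' c')
    (hS : ∀ v ∈ S, v ∈ S' → v = u) (hu : u ∈ T) (hu' : u ∈ T') :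
    ∃ d, IsPrismCycle G (S ∪ S') ((T ∪ T') \ {u}) d := by
  obtain ⟨i, m, rfl⟩ := h.vertical u hu
  obtain ⟨m', hm'⟩ : ∃ m',
      IsPrismCycle G S' T' (↑((u, i.rev) :: (u, i.rev.rev) :: m') : Cycle (V × Fin 2)) := by
    obtain ⟨j, m', rfl⟩ := h'.vertical u hu'
    rcases fin_two_eq_or_rev i j with rfl | rfl
    · refine ⟨m'.reverse, ?_⟩
      convert h'.reverse using 1
      rw [Cycle.reverse_coe, Cycle.coe_eq_coe]
      simpa using (List.isRotated_append (l := m'.reverse) (l' := [(u, j.rev), (u, j)])).symm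
    · exact ⟨m', h'⟩
  have n₁ := h.nodup
  have n₂ := hm'.nodup
  have e₁ := h.mem_iff
  have e₂ := hm'.mem_iff
  simp only [Cycle.nodup_coe_iff, List.nodup_cons, List.mem_cons, Fin.rev_rev, not_or,
    Cycle.mem_coe_iff] at n₁ n₂ e₁ e₂
  have hdisj : m'.Disjoint m := fun x hx' hx => by
    have := hS x.1 ((e₁ x).1 (by simp [hx])) ((e₂ x).1 (by simp [hx']))
    obtain ⟨w, k⟩ := x
    obtain rfl : w = u := this
    rcases fin_two_eq_or_rev i k with rfl | rfl
    · exact n₁.1.2 hx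
    · exact n₁.2.1 hx
  refine ⟨(↑((u, i) :: m' ++ (u, i.rev) :: m) : Cycle (V × Fin 2)), ?_, ?_, ?_, ?_⟩
  · rw [Cycle.nodup_coe_iff, List.nodup_append']
    simp only [List.nodup_cons, List.disjoint_cons_left, List.disjoint_cons_right, List.mem_cons,
      not_or]
    tauto
  · refine cycle_chain_merge h.chain ?_
    simpa using hm'.chain
  · intro x
    rw [Set.mem_union, ← e₁, ← e₂]
    simp only [Cycle.mem_coe_iff, List.mem_append, List.mem_cons]
    tauto
  · rintro v ⟨hv | hv, hvu⟩
    · obtain ⟨j, p, q, rfl⟩ := h.exists_infix hv hvu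
      refine ⟨j, ?_⟩
      simpa using cycle_coe_append_infix ((u, i) :: m' ++ [(u, i.rev)]) p q []
    · obtain ⟨j, p, q, rfl⟩ := hm'.exists_infix hv hvu
      refine ⟨j, ?_⟩
      simpa using cycle_coe_append_infix [(u, i)] p q ((u, i.rev) :: m)

theorem exists_cyclic_list {B : G.Subgraph}
    (h : IsEvenCycleGraph B.coe ∨ IsSingleEdgeGraph B.coe) :
    ∃ v l, Even (v :: l).length ∧ (v :: l).Nodup ∧ (∀ x, x ∈ v :: l ↔ x ∈ B.verts) ∧
      (v :: l ++ [v]).IsChain G.Adj := by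
  rcases h with ⟨n, hn, hn3, ⟨e⟩⟩ | ⟨u, v, huv, hadj, hall⟩
  · obtain ⟨k, rfl⟩ : ∃ k, n = k + 2 := ⟨n - 2, by omega⟩
    have hcons := List.ofFn_succ (f := fun i : Fin (k + 2) => (e.symm i : V))
    refine ⟨e.symm 0, List.ofFn fun i : Fin (k + 1) => (e.symm i.succ : V), ?_⟩
    rw [← hcons]
    refine ⟨by simpa using hn, List.nodup_ofFn.2 (Subtype.val_injective.comp e.symm.injective),
      fun x => ?_, ?_⟩
    · rw [List.mem_ofFn']
      exact ⟨fun ⟨i, hi⟩ => hi ▸ (e.symm i).2, fun hx => ⟨e ⟨x, hx⟩, by simp⟩⟩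
    · have hadj : ∀ i j : Fin (k + 2), j - i = 1 → G.Adj (e.symm i) (e.symm j) := fun i j hij =>
        B.adj_sub (e.symm.map_adj_iff.2 (cycleGraph_adj.2 (.inr hij)))
      rw [List.isChain_append]
      refine ⟨List.isChain_ofFn.2 fun i hi => hadj _ _ ?_, by simp, ?_⟩
      · ext
        simp [Fin.sub_val_of_le, Fin.le_def]
      · intro x hx y hy
        rw [List.getLast?_eq_getElem?, List.getElem?_ofFn] at hx
        simp only [List.length_ofFn, List.head?_cons, Option.mem_def, Option.some.injEq] at hx hy
        rw [dif_pos (by omega), Option.some.injEq] at hx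
        subst hx hy
        refine hadj _ _ ?_
        rw [sub_eq_iff_eq_add, add_comm (1 : Fin (k + 2))]
        exact (Fin.last_add_one _).symm
  · refine ⟨u, [v], by simp, by simpa using fun h => huv (Subtype.ext h), fun x => ?_, ?_⟩
    · constructor
      · simp only [List.mem_cons, List.not_mem_nil, or_false]
        rintro (rfl | rfl)
        exacts [u.2, v.2]
      · intro hx
        have := hall ⟨x, hx⟩
        simpa [Subtype.ext_iff] using this
    · have := B.adj_sub hadj
      simp [this, this.symm]

theorem exists_isPrismCycle {B : G.Subgraph}
    (h : IsEvenCycleGraph B.coe ∨ IsSingleEdgeGraph B.coe) :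
    ∃ c, IsPrismCycle G B.verts B.verts c := by
  obtain ⟨v, l, heven, hnodup, hmem, hchain⟩ := exists_cyclic_list h
  refine ⟨(↑(zigzag 0 (v :: l)) : Cycle (V × Fin 2)), Cycle.nodup_coe_iff.2 (nodup_zigzag hnodup 0),
    chain_zigzag heven hchain, fun x => ?_, fun w hw => ?_⟩
  · rw [Cycle.mem_coe_iff, mem_zigzag, hmem]
  · obtain ⟨j, p, q, hq⟩ := zigzag_vertical ((hmem w).2 hw) 0
    refine ⟨j, ?_⟩
    rw [hq]
    simpa using cycle_coe_append_infix [] p q []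

end PrismCycle

/-- A family of blocks with connected union whose prism has a Hamiltonian cycle using the vertical
edge over every vertex that lies in a unique block of the family. -/
structure IsPrismFamily (G : SimpleGraph V) (F : Set G.Subgraph) : Prop where
  isBlock : ∀ B ∈ F, IsBlock G B
  connected : (sSup F).Connected
  exists_cycle : ∃ c, IsPrismCycle G (sSup F).verts
    {v | v ∈ (sSup F).verts ∧ ∀ B ∈ F, ∀ C ∈ F, v ∈ B.verts → v ∈ C.verts → B = C} c

theorem isPrismFamily_singleton {G : SimpleGraph V} (hG : IsSBEP G) {B : G.Subgraph}
    (hB : IsBlock G B) : IsPrismFamily G {B} := by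
  refine ⟨by simpa using hB, by simpa using ⟨hB.1⟩, ?_⟩
  obtain ⟨c, hc⟩ := exists_isPrismCycle (hG.2.1 B hB)
  exact ⟨c, by simpa using hc⟩

theorem IsPrismFamily.insert {G : SimpleGraph V} (hG : IsSBEP G) {F : Set G.Subgraph}
    (hF : IsPrismFamily G F) {B : G.Subgraph} (hB : IsBlock G B) {u v : V}
    (huF : u ∈ (sSup F).verts) (hvF : v ∉ (sSup F).verts) (huB : u ∈ B.verts)
    (hvB : v ∈ B.verts) : IsPrismFamily G (insert B F) := by
  have hBF : B ∉ F := fun h => hvF ((le_sSup h : B ≤ sSup F).1 hvB)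
  have hinter : ∀ x ∈ (sSup F).verts, x ∈ B.verts → x = u := fun x hx hx' =>
    hB.subsingleton_inter hF.isBlock hF.connected hBF ⟨hx', hx⟩ ⟨huB, huF⟩
  have hsup : sSup (Insert.insert B F) = sSup F ⊔ B := by rw [sSup_insert, sup_comm]
  refine ⟨by simpa [hB] using hF.isBlock, ?_, ?_⟩
  · rw [hsup]
    exact Subgraph.connected_sup hF.connected.preconnected ⟨hB.1.preconnected⟩ ⟨u, huF, huB⟩
  obtain ⟨c, hc⟩ := hF.exists_cycle
  obtain ⟨c', hc'⟩ := exists_isPrismCycle (hG.2.1 B hB)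
  obtain ⟨d, hd⟩ := hc.merge hc' hinter ⟨huF, fun C hC D hD huC huD => by
    rcases hG.2.2 u B C D ⟨hB, huB⟩ ⟨hF.isBlock C hC, huC⟩ ⟨hF.isBlock D hD, huD⟩ with h | h | h
    · exact absurd (h ▸ hC) hBF
    · exact absurd (h ▸ hD) hBF
    · exact h⟩ huB
  refine ⟨d, ?_⟩
  rw [hsup]
  refine ⟨hd.nodup, hd.chain, hd.mem_iff, fun w ⟨hw, hw'⟩ => hd.vertical w ⟨?_, ?_⟩⟩
  · exact hw.imp (fun h => ⟨h, fun C hC D hD => hw' C (.inr hC) D (.inr hD)⟩) id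
  · rintro rfl
    simp only [Subgraph.verts_sSup, Set.mem_iUnion] at huF
    obtain ⟨C, hC, hwC⟩ := huF
    exact hBF (hw' B (.inl rfl) C (.inr hC) huB hwC ▸ hC)

/-- Every SBEP graph is prism-hamiltonian. -/
theorem stmt_5 {V : Type*} [Fintype V] [DecidableEq V] (G : SimpleGraph V)
    (hG : IsSBEP G) : HasHamCycle (prism G) := by
  obtain ⟨v₀⟩ := hG.1.nonempty
  obtain ⟨B₀, hv₀, hB₀⟩ := exists_isBlock_ge (isNonsep_singletonSubgraph (G := G) v₀)
  obtain ⟨F, hle, hF⟩ := Finite.exists_le_maximal (isPrismFamily_singleton hG hB₀)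
  have hv₀F : v₀ ∈ (sSup F).verts :=
    (hv₀.trans (le_sSup (hle rfl)) : G.singletonSubgraph v₀ ≤ sSup F).1 rfl
  have huniv : ∀ v, v ∈ (sSup F).verts := by
    by_contra! h
    obtain ⟨v, hv⟩ := h
    obtain ⟨p⟩ := hG.1.preconnected v₀ v
    obtain ⟨d, -, h₁, h₂⟩ := p.exists_boundary_dart _ hv₀F hv
    obtain ⟨B, hle, hB⟩ := exists_isBlock_ge (isNonsep_subgraphOfAdj d.adj)
    have hins := hF.prop.insert hG hB h₁ h₂ (hle.1 (by simp)) (hle.1 (by simp))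
    have hBF : B ∈ F := hF.le_of_ge hins (Set.subset_insert _ _) (Set.mem_insert _ _)
    exact h₂ ((le_sSup hBF : B ≤ sSup F).1 (hle.1 (by simp)))
  obtain ⟨c, hc⟩ := hF.prop.exists_cycle
  obtain ⟨x, hx⟩ : ∃ x, x ≠ v₀ := by
    obtain ⟨v, l, heven, hnodup, -, -⟩ := exists_cyclic_list (hG.2.1 B₀ hB₀)
    match l with
    | [] => simp at heven
    | w :: l =>
      by_cases h : v = v₀
      · exact ⟨w, by rintro rfl; simp [h] at hnodup⟩
      · exact ⟨v, h⟩
  exact hasHamCycle_of_cycle hc.nodup hc.chain (fun y => (hc.mem_iff y).2 (huniv y.1))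
    (a := (v₀, 0)) (b := (v₀, 1)) (d := (x, 0)) (by simp) (by simp [hx.symm]) (by simp)
end

section
/- Let G be a connected P4-free simple graph and let S be a cutset of G such that each vertex in S is adjacent to vertices of at least two distinct connected components of G − S. Then for each vertex u in S and each connected component R of G − S, if u is adjacent to some vertex of R then u is adjacent to every vertex of R. -/
open SimpleGraph

variable {V : Type*} {W : Type*}

/-- Vertices of distinct components of `G - S` are not adjacent. -/
theorem IsCompOf.not_adj {G : SimpleGraph V} {S R R' : Set V} (hR : IsCompOf G S R)
    (hR' : IsCompOf G S R') (hne : R ≠ R') {x z : V} (hx : x ∈ R) (hz : z ∈ R') :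
    ¬ G.Adj x z := by
  intro hxz
  have hconn : (G.induce (R ∪ R')).Connected :=
    connected_induce_union hR.2.1.preconnected hR'.2.1.preconnected hx hz hxz
  have hsub : R ∪ R' ⊆ Sᶜ := Set.union_subset hR.1 hR'.1
  exact hne ((hR.2.2 _ Set.subset_union_left hsub hconn).symm.trans
    (hR'.2.2 _ Set.subset_union_right hsub hconn))

/-- A `P₄`-free graph has no four vertices `a`, `b`, `c`, `d` inducing a path in this order. -/
theorem P4Free.false_of_induced_path {G : SimpleGraph V} (h : P4Free G) {a b c d : V}
    (hab : G.Adj a b) (hbc : G.Adj b c) (hcd : G.Adj c d)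
    (hac : ¬ G.Adj a c) (hbd : ¬ G.Adj b d) (had : ¬ G.Adj a d) : False := by
  have hadj : ∀ i j, G.Adj (![a, b, c, d] i) (![a, b, c, d] j) ↔ (pathGraph 4).Adj i j := by
    intro i j
    fin_cases i <;> fin_cases j <;> simp_all [pathGraph_adj, G.adj_comm]
  have hinj : Function.Injective ![a, b, c, d] := by
    intro i j
    fin_cases i <;> fin_cases j <;> simp <;> rintro rfl <;> simp_all [G.adj_comm]
  exact h.false ⟨⟨_, hinj⟩, hadj _ _⟩

/-- In a connected `P₄`-free graph, for a cutset `S` each of whose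
vertices is adjacent to at least two components of `G - S`: if `u ∈ S` is adjacent
to one vertex of a component `R` of `G - S`, then it is adjacent to all of `R`. -/
theorem stmt_8 {V : Type*} [Fintype V] (G : SimpleGraph V) (hconn : G.Connected)
    (hP4 : P4Free G) (S : Set V) (hcut : IsCutset G S)
    (hadj : ∀ u ∈ S, ∃ R₁ R₂ : Set V, IsCompOf G S R₁ ∧ IsCompOf G S R₂ ∧ R₁ ≠ R₂ ∧
      AdjToSet G u R₁ ∧ AdjToSet G u R₂) :
    ∀ u ∈ S, ∀ R : Set V, IsCompOf G S R → AdjToSet G u R → ∀ v ∈ R, G.Adj u v := by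
  intro u hu R hR ⟨w, hw, huw⟩ v hv
  obtain ⟨R', hR', hne, z, hz, huz⟩ :
      ∃ R', IsCompOf G S R' ∧ R ≠ R' ∧ AdjToSet G u R' := by
    obtain ⟨R₁, R₂, h₁, h₂, h₁₂, hu₁, hu₂⟩ := hadj u hu
    by_cases h : R = R₁
    · exact ⟨R₂, h₂, h ▸ h₁₂, hu₂⟩
    · exact ⟨R₁, h₁, h, hu₁⟩
  have step : ∀ x ∈ R, ∀ y ∈ R, G.Adj x y → G.Adj u x → G.Adj u y := by
    intro x hx y hy hxy hux
    by_contra huy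
    exact hP4.false_of_induced_path huz.symm hux hxy
      (fun h => hR.not_adj hR' hne hx hz h.symm) huy
      (fun h => hR.not_adj hR' hne hy hz h.symm)
  obtain ⟨p⟩ := hR.2.1.preconnected ⟨w, hw⟩ ⟨v, hv⟩
  have walk : ∀ {x y : R}, (G.induce R).Walk x y → G.Adj u x → G.Adj u y := by
    intro x y q
    induction q with
    | nil => exact id
    | cons hxy _ ih =>
      exact fun hux => ih (step _ (Subtype.coe_prop _) _ (Subtype.coe_prop _) hxy hux)
  exact walk p huw
end

section
/- Let G be a connected P4-free simple graph and let S be a cutset of G such that each vertex in S is adjacent to vertices of at least two distinct connected components of G − S. If S is a minimal cutset of G (no proper subset of S is a cutset of G), then every vertex of S is adjacent in G to every vertex of V(G) − S; that is, the bipartite subgraph of G between S and V(G) − S is complete bipartite. -/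
open SimpleGraph

variable {V : Type*} {W : Type*}

/-- An induced connected set that meets `A` and is not contained in `A` has an edge leaving `A`. -/
theorem SimpleGraph.Connected.exists_adj_of_induce {G : SimpleGraph V} {R A : Set V}
    (hR : (G.induce R).Connected) {x y : V} (hx : x ∈ R) (hy : y ∈ R) (hxA : x ∈ A) (hyA : y ∉ A) :
    ∃ a ∈ R, ∃ b ∈ R, a ∈ A ∧ b ∉ A ∧ G.Adj a b := by
  obtain ⟨p⟩ := hR.preconnected ⟨x, hx⟩ ⟨y, hy⟩
  obtain ⟨d, -, h₁, h₂⟩ := p.exists_boundary_dart (Subtype.val ⁻¹' A) hxA hyA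
  exact ⟨d.fst, d.fst.2, d.snd, d.snd.2, h₁, h₂, d.adj⟩

theorem IsCompOf.nonempty {G : SimpleGraph V} {S R : Set V} (hR : IsCompOf G S R) : R.Nonempty := by
  obtain ⟨x⟩ := hR.2.1.nonempty
  exact ⟨x, x.2⟩

theorem IsCompOf.mem_of_adj {G : SimpleGraph V} {S R : Set V} (hR : IsCompOf G S R) {a b : V}
    (ha : a ∈ R) (hb : b ∉ S) (hab : G.Adj a b) : b ∈ R := by
  have hconn : (G.induce (R ∪ {a, b})).Connected :=
    induce_union_connected hR.2.1.preconnected (induce_pair_connected_of_adj hab).preconnected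
      ⟨a, ha, Set.mem_insert a {b}⟩
  rw [← hR.2.2 _ Set.subset_union_left
    (Set.union_subset hR.1 (Set.pair_subset (hR.1 ha) hb)) hconn]
  simp

theorem IsCompOf.subset_of_connected {G : SimpleGraph V} {S R T : Set V} (hR : IsCompOf G S R)
    (hT : (G.induce T).Connected) (hTS : T ⊆ Sᶜ) {x : V} (hxR : x ∈ R) (hxT : x ∈ T) : T ⊆ R := by
  intro y hy
  by_contra hyR
  obtain ⟨a, -, b, hbT, haR, hbR, hab⟩ := hT.exists_adj_of_induce hxT hy hxR hyR
  exact hbR (hR.mem_of_adj haR (hTS hbT) hab)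

theorem IsCompOf.eq_of_mem {G : SimpleGraph V} {S R T : Set V} (hR : IsCompOf G S R)
    (hT : IsCompOf G S T) {x : V} (hxR : x ∈ R) (hxT : x ∈ T) : R = T :=
  (hT.subset_of_connected hR.2.1 hR.1 hxT hxR).antisymm
    (hR.subset_of_connected hT.2.1 hT.1 hxR hxT)

theorem exists_isCompOf_mem [Finite V] (G : SimpleGraph V) {S : Set V} {v : V} (hv : v ∉ S) :
    ∃ R, IsCompOf G S R ∧ v ∈ R := by
  obtain ⟨R, hvR, hR⟩ :=
    (Set.toFinite {R : Set V | R ⊆ Sᶜ ∧ (G.induce R).Connected}).exists_le_maximal (a := {v})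
      ⟨by simpa using hv, by simp⟩
  exact ⟨R, ⟨hR.prop.1, hR.prop.2, fun T hRT hTS hT => (hR.eq_of_le ⟨hTS, hT⟩ hRT).symm⟩,
    hvR rfl⟩

theorem isCutset_of_isCompOf [Finite V] {G : SimpleGraph V} {S R T : Set V} (hR : IsCompOf G S R)
    (hT : IsCompOf G S T) (hne : R ≠ T) : IsCutset G S :=
  (Set.one_lt_ncard (Set.toFinite _)).2 ⟨R, hR, T, hT, hne⟩

/-- A component of `G - S` with no neighbour of `u` remains a component when `u` is put back. -/
theorem IsCompOf.diff_singleton {G : SimpleGraph V} {S R : Set V} (hR : IsCompOf G S R) {u : V}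
    (hu : ¬ AdjToSet G u R) : IsCompOf G (S \ {u}) R := by
  refine ⟨hR.1.trans (Set.compl_subset_compl.2 Set.sdiff_subset), hR.2.1, fun T hRT hTS hT => ?_⟩
  refine Set.Subset.antisymm (fun y hy => ?_) hRT
  by_contra hyR
  obtain ⟨x, hx⟩ := hR.nonempty
  obtain ⟨a, -, b, hbT, haR, hbR, hab⟩ := hT.exists_adj_of_induce (hRT hx) hy hx hyR
  have hbu : b ≠ u := by
    rintro rfl
    exact hu ⟨a, haR, hab.symm⟩
  exact hbR (hR.mem_of_adj haR (fun hbS => hTS hbT ⟨hbS, hbu⟩) hab)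

/-- A vertex of a minimal cutset `S` has a neighbour in every component of `G - S`. -/
theorem IsCompOf.adjToSet_of_minimal [Finite V] {G : SimpleGraph V} {S R : Set V}
    (hmin : ∀ S' : Set V, S' ⊂ S → ¬ IsCutset G S') (hR : IsCompOf G S R) {u : V} (hu : u ∈ S) :
    AdjToSet G u R := by
  by_contra h
  obtain ⟨T, hT, huT⟩ := exists_isCompOf_mem G (S := S \ {u}) (v := u) (by simp)
  refine hmin (S \ {u}) (Set.sdiff_singleton_ssubset.2 hu)
    (isCutset_of_isCompOf (hR.diff_singleton h) hT ?_)
  rintro rfl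
  exact hR.1 huT hu

theorem P4Free.adj_of_adj {G : SimpleGraph V} (hG : P4Free G) {a b c d : V} (hab : G.Adj a b)
    (hbc : G.Adj b c) (hcd : G.Adj c d) (hbd : ¬ G.Adj b d) (had : ¬ G.Adj a d) (hne : a ≠ d) :
    G.Adj a c := by
  by_contra hac
  have hne_ac : a ≠ c := by
    rintro rfl
    exact had hcd
  have hne_bd : b ≠ d := by
    rintro rfl
    exact had hab
  refine hG.false ⟨⟨![a, b, c, d], ?_⟩, ?_⟩
  · intro i j hij
    fin_cases i <;> fin_cases j <;>
      simp_all [hab.ne, hab.ne', hbc.ne, hbc.ne', hcd.ne, hcd.ne', hne.symm, hne_ac.symm,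
        hne_bd.symm]
  · intro i j
    change G.Adj (![a, b, c, d] i) (![a, b, c, d] j) ↔ _
    fin_cases i <;> fin_cases j <;>
      simp_all [pathGraph_adj, G.adj_comm]

/-- In a connected `P₄`-free graph, if `S` is a minimal cutset
(each vertex of which is adjacent to at least two components of `G - S`), then every
vertex of `S` is adjacent to every vertex of `V(G) - S`. -/
theorem stmt_10 {V : Type*} [Fintype V] (G : SimpleGraph V) (hconn : G.Connected)
    (hP4 : P4Free G) (S : Set V) (hcut : IsCutset G S)
    (hadj : ∀ u ∈ S, ∃ R₁ R₂ : Set V, IsCompOf G S R₁ ∧ IsCompOf G S R₂ ∧ R₁ ≠ R₂ ∧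
      AdjToSet G u R₁ ∧ AdjToSet G u R₂)
    (hmin : ∀ S' : Set V, S' ⊂ S → ¬ IsCutset G S') :
    ∀ u ∈ S, ∀ v : V, v ∉ S → G.Adj u v := by
  intro u hu v hv
  by_contra huv
  obtain ⟨R, hR, hvR⟩ := exists_isCompOf_mem G hv
  obtain ⟨x, hxR, hux⟩ := hR.adjToSet_of_minimal hmin hu
  obtain ⟨T, hT, hne, y, hyT, huy⟩ : ∃ T, IsCompOf G S T ∧ R ≠ T ∧ AdjToSet G u T := by
    obtain ⟨R₁, R₂, h₁, h₂, hne, hu₁, hu₂⟩ := hadj u hu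
    by_cases h : R = R₁
    · exact ⟨R₂, h₂, h ▸ hne, hu₂⟩
    · exact ⟨R₁, h₁, h, hu₁⟩
  obtain ⟨a, haR, b, hbR, hua, hub, hab⟩ :=
    hR.2.1.exists_adj_of_induce (A := {w | G.Adj u w}) hxR hvR hux huv
  have hyR : y ∉ R := fun h => hne (hR.eq_of_mem hT h hyT)
  have hy {w : V} (hw : w ∈ R) : ¬ G.Adj w y := fun h => hyR (hR.mem_of_adj hw (hT.1 hyT) h)
  exact hub (hP4.adj_of_adj hab.symm hua.symm huy (hy haR) (hy hbR)
    (ne_of_mem_of_not_mem hbR hyR)).symm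
end

section
/- Let G be a connected simple graph with toughness τ(G) = t ≤ 1, and let S be a tough-set of G. Then for any nonempty proper subset S′ of S, the number of connected components of G − S that contain a vertex adjacent to some vertex of S′ is at least |S′|/t + 1. -/
open SimpleGraph

variable {V : Type*} {W : Type*}

/-- A connected induced subgraph on a proper superset of a nonempty set `R` contains an edge
leaving `R`. -/
theorem exists_adj_of_induce_connected {G : SimpleGraph V} {R R' : Set V}
    (hR : R.Nonempty) (hsub : R ⊆ R') (hconn : (G.induce R').Connected) (hne : R' ≠ R) :
    ∃ u ∈ R, ∃ v ∈ R' \ R, G.Adj u v := by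
  obtain ⟨a, ha⟩ := hR
  obtain ⟨b, hb, hbR⟩ := Set.exists_of_ssubset (hsub.ssubset_of_ne hne.symm)
  obtain ⟨p⟩ := hconn.preconnected ⟨a, hsub ha⟩ ⟨b, hb⟩
  obtain ⟨d, -, hd₁, hd₂⟩ := p.exists_boundary_dart (Subtype.val ⁻¹' R) ha hbR
  exact ⟨_, hd₁, _, ⟨d.snd.2, hd₂⟩, d.adj⟩

/-- A component of `G - S` with no neighbor in `S'` is a component of `G - (S \ S')`. -/
theorem IsCompOf.sdiff {G : SimpleGraph V} {S S' R : Set V} (hR : IsCompOf G S R)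
    (hadj : ¬ ∃ u ∈ S', AdjToSet G u R) : IsCompOf G (S \ S') R := by
  obtain ⟨hRS, hRconn, hmax⟩ := hR
  refine ⟨fun x hx hxS => hRS hx hxS.1, hRconn, fun R' hRR' hR'T hR' => ?_⟩
  by_contra hne
  obtain ⟨u, hu, v, ⟨hvR', hvR⟩, huv⟩ :=
    exists_adj_of_induce_connected (Set.nonempty_coe_sort.mp hRconn.nonempty) hRR' hR' hne
  by_cases hvS : v ∈ S
  · by_cases hvS' : v ∈ S'
    · exact hadj ⟨v, hvS', u, hu, huv.symm⟩
    · exact hR'T hvR' ⟨hvS, hvS'⟩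
  · have hunion : (G.induce (R ∪ {u, v})).Connected :=
      induce_union_connected hRconn.preconnected
        (induce_pair_connected_of_adj huv).preconnected ⟨u, hu, by simp⟩
    have heq := hmax (R ∪ {u, v}) Set.subset_union_left
      (by rintro x (hx | rfl | rfl); exacts [hRS hx, hRS hu, hvS]) hunion
    exact hvR (heq ▸ by simp)

/-- Returning a nonempty subset `S'` of `S` to `G - S` merges at most the components
adjacent to `S'`, and leaves at least one component meeting `S'`. -/
theorem numComp_add_one_le [Finite V] (G : SimpleGraph V) {S S' : Set V} (hsub : S' ⊆ S)
    (hne : S'.Nonempty) :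
    numComp G S + 1 ≤ numComp G (S \ S') +
      {R : Set V | IsCompOf G S R ∧ ∃ u ∈ S', AdjToSet G u R}.ncard := by
  obtain ⟨s, hs⟩ := hne
  obtain ⟨R₀, hR₀, hsR₀⟩ := exists_isCompOf_mem G (S := S \ S') (fun h => h.2 hs)
  set A := {R : Set V | IsCompOf G S R ∧ ∃ u ∈ S', AdjToSet G u R}
  have hAC : A ⊆ {R | IsCompOf G S R} := fun R hR => hR.1
  have hle : (insert R₀ ({R | IsCompOf G S R} \ A)).ncard ≤ numComp G (S \ S') := by
    refine Set.ncard_le_ncard ?_ (Set.toFinite _)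
    rintro R (rfl | ⟨hR, hRA⟩)
    · exact hR₀
    · exact IsCompOf.sdiff hR fun h => hRA ⟨hR, h⟩
  rw [Set.ncard_insert_of_notMem (fun h => h.1.1 hsR₀ (hsub hs)) (Set.toFinite _)] at hle
  have hcard := Set.ncard_sdiff_add_ncard_of_subset hAC
  unfold numComp at hle ⊢
  omega

/-- If `τ(G) = t ≤ 1` and `S` is a tough-set of `G`, then every
nonempty proper subset `S'` of `S` is adjacent to at least `|S'|/t + 1` components
of `G - S`. -/
theorem stmt_12 {V : Type*} [Fintype V] (G : SimpleGraph V) (t : ℝ)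
    (hconn : G.Connected) (htough : IsToughness G t) (ht : t ≤ 1)
    (S : Set V) (hS : ToughSet G t S) (S' : Set V) (hsub : S' ⊆ S)
    (hne : S'.Nonempty) (hprop : S' ≠ S) :
    (S'.ncard : ℝ) / t + 1 ≤
      ({R : Set V | IsCompOf G S R ∧ ∃ u ∈ S', AdjToSet G u R}.ncard : ℝ) := by
  obtain ⟨hcut, hcard⟩ := hS
  have hcomp := numComp_add_one_le G hsub hne
  set k := {R : Set V | IsCompOf G S R ∧ ∃ u ∈ S', AdjToSet G u R}.ncard
  have hc : (0 : ℝ) < numComp G S := by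
    exact_mod_cast (by unfold IsCutset at hcut; omega : 0 < numComp G S)
  have hSpos : (0 : ℝ) < S.ncard := by
    exact_mod_cast (Set.ncard_pos (Set.toFinite S)).mpr (hne.mono hsub)
  have htpos : 0 < t := pos_of_mul_pos_left (hcard ▸ hSpos) hc.le
  have hdiff : ((S \ S').ncard : ℝ) + S'.ncard = S.ncard := by
    exact_mod_cast Set.ncard_sdiff_add_ncard_of_subset hsub
  suffices h : (S'.ncard : ℝ) + t ≤ t * k by
    rw [div_add_one htpos.ne', div_le_iff₀ htpos]
    linarith
  by_cases hT : IsCutset G (S \ S')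
  · have htough' := htough.1 _ hT
    have hcomp' : (numComp G S : ℝ) + 1 ≤ numComp G (S \ S') + k := by exact_mod_cast hcomp
    nlinarith [mul_le_mul_of_nonneg_left hcomp' htpos.le]
  · have hk : (numComp G S : ℝ) ≤ k := by
      exact_mod_cast (by unfold IsCutset at hT; omega : numComp G S ≤ k)
    have hlt : (S'.ncard : ℝ) + 1 ≤ S.ncard := by
      exact_mod_cast Set.ncard_lt_ncard (hsub.ssubset_of_ne hprop) (Set.toFinite S)
    linarith [mul_le_mul_of_nonneg_left hk htpos.le]
end
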